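/- arXiv:2312.07862 — 2 statements merged into one kernel-verified Lean document; each statement's English description precedes it below -/
import Mathlib

section
/- Value representation: the optimal value of the partially observed risk-sensitive control problem coincides with the value function of the information-state MDP evaluated at the initial information state, namely V_N(x, Q_0^Y ⊗ δ_0, 1) = J_N(x) for every x ∈ X. -/
open MeasureTheory
open scoped ENNReal NNReal

noncomputable section

namespace DIMG

universe u

/-- The information-state update operator `Ψ(x,a,x',μ,z)`:
`Ψ(x,a,x',μ,z)(B) = ∫_{Y×[0,∞)} ∫_Y 1_B(y', s + z·c(x,y,a)) q(x',y'|x,y,a) ν(dy') μ(dy,ds)`. -/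
noncomputable def Psi {X Y A : Type u} [MeasurableSpace X] [MeasurableSpace Y]
    (q : X → Y → X → Y → A → ℝ) (c : X → Y → A → ℝ) (ν : Measure Y)
    (x : X) (a : A) (x' : X) (μ : Measure (Y × ℝ)) (z : ℝ) : Measure (Y × ℝ) :=
  Measure.map (fun p : (Y × ℝ) × Y => (p.2, p.1.2 + z * c x p.1.1 a))
    ((μ.prod ν).withDensity fun p => ENNReal.ofReal (q x' p.2 x p.1.1 a))

/-- Observable histories: `Hist X A n = {(x_0,a_0,x_1,…,a_{n−1},x_n)}`. -/
def Hist (X A : Type u) : ℕ → Type u :=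
  fun n => Nat.rec X (fun _ ih => ih × A × X) n

instance histMS (X A : Type u) [MeasurableSpace X] [MeasurableSpace A] :
    ∀ n, MeasurableSpace (Hist X A n)
  | 0 => inferInstanceAs (MeasurableSpace X)
  | n + 1 => letI := histMS X A n; inferInstanceAs (MeasurableSpace (Hist X A n × A × X))

/-- The current observation `x_n` of a history `h_n`. -/
def lastObs {X A : Type u} : ∀ n, Hist X A n → X
  | 0, h => h
  | _ + 1, h => h.2.2

/-- Full state paths `((x_0,y_0),…,(x_n,y_n))`. -/
def Path (X Y : Type u) : ℕ → Type u :=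
  fun n => Nat.rec (X × Y) (fun _ ih => ih × (X × Y)) n

instance pathMS (X Y : Type u) [MeasurableSpace X] [MeasurableSpace Y] :
    ∀ n, MeasurableSpace (Path X Y n)
  | 0 => inferInstanceAs (MeasurableSpace (X × Y))
  | n + 1 => letI := pathMS X Y n; inferInstanceAs (MeasurableSpace (Path X Y n × (X × Y)))

/-- The current observable state `X_n` along a path. -/
def lastX {X Y : Type u} : ∀ n, Path X Y n → X
  | 0, p => p.1
  | _ + 1, p => p.2.1

/-- The current unobservable state `Y_n` along a path. -/
def lastY {X Y : Type u} : ∀ n, Path X Y n → Y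
  | 0, p => p.2
  | _ + 1, p => p.2.2

/-- The observable history generated by a path under the policy `g`
(the actions being `A_k = g_k(X_0,A_0,…,X_k)`). -/
def obsHist {X Y A : Type u} (g : ∀ n, Hist X A n → A) : ∀ n, Path X Y n → Hist X A n
  | 0, p => p.1
  | n + 1, p => (obsHist g n p.1, g n (obsHist g n p.1), p.2.1)

/-- The discounted accumulated cost `S_n = Σ_{k=0}^{n−1} β^k c(X_k,Y_k,A_k)` along a path. -/
noncomputable def Scost {X Y A : Type u} (c : X → Y → A → ℝ) (β : ℝ)
    (g : ∀ n, Hist X A n → A) : ∀ n, Path X Y n → ℝ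
  | 0, _ => 0
  | n + 1, p =>
      Scost c β g n p.1 + β ^ n * c (lastX n p.1) (lastY n p.1) (g n (obsHist g n p.1))

/-- The law `ℙ^π_x` of the partially observed process `(X_k,Y_k)_{k≤n}`: `X_0 = x`,
`Y_0 ∼ Q_0^Y`, and given the past, `(X_{k+1},Y_{k+1})` has density
`q(·,·|X_k,Y_k,A_k)` w.r.t. `λ⊗ν` with `A_k = g_k(X_0,A_0,…,X_k)`. -/
noncomputable def pathLaw {X Y A : Type u} [MeasurableSpace X] [MeasurableSpace Y]
    [MeasurableSpace A] (lam : Measure X) (ν : Measure Y) (Q0Y : Measure Y)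
    (q : X → Y → X → Y → A → ℝ) (g : ∀ n, Hist X A n → A) (x : X) :
    ∀ n, Measure (Path X Y n)
  | 0 => (Measure.dirac x).prod Q0Y
  | n + 1 =>
      (pathLaw lam ν Q0Y q g x n).bind fun p =>
        (Measure.dirac p).prod
          ((lam.prod ν).withDensity fun p' =>
            ENNReal.ofReal (q p'.1 p'.2 (lastX n p) (lastY n p) (g n (obsHist g n p))))

/-- The information states `μ_n(·|h_n)`: `μ_0 = Q_0^Y ⊗ δ_0` and
`μ_{n+1}(·|(h_n,a,x')) = Ψ(x_n,a,x',μ_n(·|h_n),β^n)`. -/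
noncomputable def infoState {X Y A : Type u} [MeasurableSpace X] [MeasurableSpace Y]
    (ν : Measure Y) (Q0Y : Measure Y) (q : X → Y → X → Y → A → ℝ) (c : X → Y → A → ℝ)
    (β : ℝ) : ∀ n, Hist X A n → Measure (Y × ℝ)
  | 0, _ => Q0Y.prod (Measure.dirac (0 : ℝ))
  | n + 1, h =>
      Psi q c ν (lastObs n h.1) h.2.1 h.2.2 (infoState ν Q0Y q c β n h.1) (β ^ n)

/-- The product `∏_{k=0}^n D_k` of the normalizing constants along a history, where
`D_0 = 1` and `D_k = ∫_Y q^X(x_k|x_{k−1},y,a_{k−1}) μ_{k−1}^Y(dy|h_{k−1})` with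
`q^X(x'|x,y,a) = ∫_Y q(x',y'|x,y,a) ν(dy')`. -/
noncomputable def prodD {X Y A : Type u} [MeasurableSpace X] [MeasurableSpace Y]
    (ν : Measure Y) (Q0Y : Measure Y) (q : X → Y → X → Y → A → ℝ) (c : X → Y → A → ℝ)
    (β : ℝ) : ∀ n, Hist X A n → ℝ
  | 0, _ => 1
  | n + 1, h =>
      prodD ν Q0Y q c β n h.1 *
        ∫ y, (∫ y', q h.2.2 y' (lastObs n h.1) y h.2.1 ∂ν)
          ∂((infoState ν Q0Y q c β n h.1).map Prod.fst)

/-- The state space `S = X × M(Y×[0,∞)) × (0,1]` of the information-state MDP. -/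
abbrev IS (X Y : Type u) [MeasurableSpace Y] := X × Measure (Y × ℝ) × ℝ

/-- Terminal cost of the information-state MDP: `V₀(x,μ,z) = ∫ U(s) μ(dy,ds)`. -/
noncomputable def V0 {X Y : Type u} [MeasurableSpace Y] (U : ℝ → ℝ) : IS X Y → ℝ :=
  fun s => ∫ ys : Y × ℝ, U ys.2 ∂s.2.1

/-- `Efun f n x y μ z s = E^π_{xy}[U(s + z·Σ_{k=0}^{n−1} β^k c(X_k,Y_k,A_k))]` for the Markov
policy `π = (f_0,f_1,…)` of the information-state MDP, where `A_k = f_k(X_k, μ_k, β^k z)`,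
`μ_0 = μ` and `μ_{k+1} = Ψ(X_k,A_k,X_{k+1},μ_k,β^k z)` along the realized path, the
transitions having density `q`. -/
noncomputable def Efun {X Y A : Type u} [MeasurableSpace X] [MeasurableSpace Y]
    (lam : Measure X) (ν : Measure Y) (q : X → Y → X → Y → A → ℝ) (c : X → Y → A → ℝ)
    (U : ℝ → ℝ) (β : ℝ) :
    (n : ℕ) → (ℕ → IS X Y → A) → X → Y → Measure (Y × ℝ) → ℝ → ℝ → ℝ
  | 0, _, _, _, _, _, s => U s
  | n + 1, f, x, y, μ, z, s =>
      ∫ p : X × Y,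
        Efun lam ν q c U β n (fun k => f (k + 1)) p.1 p.2
            (Psi q c ν x (f 0 (x, μ, z)) p.1 μ z) (β * z)
            (s + z * c x y (f 0 (x, μ, z)))
          * q p.1 p.2 x y (f 0 (x, μ, z)) ∂(lam.prod ν)

/-- Value of a Markov policy in the information-state MDP:
`V_{nπ}(x,μ,z) = ∫ E^π_{xy}[U(s + z·Σ_{k<n} β^k c(X_k,Y_k,A_k))] μ(dy,ds)`. -/
noncomputable def Vnpi {X Y A : Type u} [MeasurableSpace X] [MeasurableSpace Y]
    (lam : Measure X) (ν : Measure Y) (q : X → Y → X → Y → A → ℝ) (c : X → Y → A → ℝ)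
    (U : ℝ → ℝ) (β : ℝ) (f : ℕ → IS X Y → A) (n : ℕ) : IS X Y → ℝ :=
  fun s => ∫ ys : Y × ℝ, Efun lam ν q c U β n f s.1 ys.1 s.2.1 s.2.2 ys.2 ∂s.2.1

/-- The optimal value function `V_n := inf over Markov policies π of V_{nπ}`. -/
noncomputable def Vopt {X Y A : Type u}
    [MeasurableSpace X] [MeasurableSpace Y] [MeasurableSpace A]
    (lam : Measure X) (ν : Measure Y) (q : X → Y → X → Y → A → ℝ) (c : X → Y → A → ℝ)
    (U : ℝ → ℝ) (β : ℝ) (D : X → Set A) (n : ℕ) (s : IS X Y) : ℝ :=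
  ⨅ f : {f : ℕ → IS X Y → A // (∀ k, Measurable (f k)) ∧ ∀ k (s : IS X Y), f k s ∈ D s.1},
    Vnpi lam ν q c U β f.1 n s

/-- The decision-maker's POMDP objective
`J_{Nπ}(x) = ∫_Y E^π_{xy}[U(Σ_{k=0}^{N−1} β^k c(X_k,Y_k,A_k))] Q_0^Y(dy)` of the
history-dependent policy `π = (g_0,…,g_{N−1})`. -/
noncomputable def Jpol {X Y A : Type u} [MeasurableSpace X] [MeasurableSpace Y]
    [MeasurableSpace A] (lam : Measure X) (ν : Measure Y) (Q0Y : Measure Y)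
    (q : X → Y → X → Y → A → ℝ) (c : X → Y → A → ℝ) (U : ℝ → ℝ) (β : ℝ)
    (g : ∀ k, Hist X A k → A) (N : ℕ) (x : X) : ℝ :=
  ∫ p, U (Scost c β g N p) ∂(pathLaw lam ν Q0Y q g x N)

open MeasurableSpace in
/-- A measurable set of a product is measurable for a countably generated coarsening of the
`σ`-algebra of the second factor. -/
theorem exists_countable_generating_of_measurableSet_prod {H E : Type*} [mH : MeasurableSpace H]
    [mE : MeasurableSpace E] {B : Set (H × E)} (hB : MeasurableSet B) :
    ∃ b : Set (Set E), b.Countable ∧ (∀ t ∈ b, MeasurableSet t) ∧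
      MeasurableSet[mH.prod (generateFrom b)] B := by
  rw [← generateFrom_prod] at hB
  induction B, hB using generateFrom_induction with
  | hC B hB _ =>
    obtain ⟨s, hs, t, ht, rfl⟩ := hB
    refine ⟨{t}, Set.countable_singleton t, by simpa using ht, ?_⟩
    exact @MeasurableSet.prod _ _ mH (generateFrom {t}) _ _ hs
      (measurableSet_generateFrom (Set.mem_singleton t))
  | empty => exact ⟨∅, Set.countable_empty, by simp, @MeasurableSet.empty _ (_)⟩
  | compl B _ ih =>
    obtain ⟨b, hb, hbm, h⟩ := ih
    exact ⟨b, hb, hbm, h.compl⟩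
  | iUnion B _ ih =>
    choose b hb hbm h using ih
    refine ⟨⋃ n, b n, Set.countable_iUnion hb, ?_, ?_⟩
    · simp only [Set.mem_iUnion, forall_exists_index]
      exact fun t n ht => hbm n t ht
    · refine MeasurableSet.iUnion fun n => ?_
      have hle : mH.prod (generateFrom (b n)) ≤ mH.prod (generateFrom (⋃ n, b n)) :=
        sup_le_sup le_rfl
          (comap_mono (generateFrom_mono (Set.subset_iUnion b n)))
      exact hle _ (h n)

open MeasurableSpace in
/-- A measurable map on a product is measurable for a countably generated coarsening of the
`σ`-algebra of the second factor. -/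
theorem exists_countablyGenerated_measurable_prod {H E V : Type*} [mH : MeasurableSpace H]
    [mE : MeasurableSpace E] [mV : MeasurableSpace V] [CountablyGenerated V] {F : H × E → V}
    (hF : Measurable F) :
    ∃ m' : MeasurableSpace E, m' ≤ mE ∧ @CountablyGenerated E m' ∧
      @Measurable _ _ (mH.prod m') mV F := by
  choose b hb hbm h using fun n => exists_countable_generating_of_measurableSet_prod
    (hF (measurableSet_natGeneratingSequence (α := V) n))
  refine ⟨generateFrom (⋃ n, b n), generateFrom_le ?_, ?_, ?_⟩
  · simp only [Set.mem_iUnion, forall_exists_index]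
    exact fun t n ht => hbm n t ht
  · exact @CountablyGenerated.mk _ (_) ⟨_, Set.countable_iUnion hb, rfl⟩
  · rw [← generateFrom_natGeneratingSequence V]
    refine @measurable_generateFrom _ _ (_) _ _ ?_
    rintro _ ⟨n, rfl⟩
    have hle : mH.prod (generateFrom (b n)) ≤ mH.prod (generateFrom (⋃ n, b n)) :=
      sup_le_sup le_rfl
        (comap_mono (generateFrom_mono (Set.subset_iUnion b n)))
    exact hle _ (h n)

/-- A family of integrable functions on a countably generated measure space has a countable
subfamily that is dense in `L¹`. -/
theorem exists_seq_integral_norm_sub_lt {H E V : Type*} [Nonempty H] [MeasurableSpace E]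
    [MeasurableSpace.CountablyGenerated E] [NormedAddCommGroup V]
    [TopologicalSpace.SeparableSpace V]
    (π : Measure E) [IsFiniteMeasure π] (F : H → E → V) (hF : ∀ h, Integrable (F h) π)
    {η : ℝ} (hη : 0 < η) :
    ∃ i : ℕ → H, ∀ h, ∃ j, ∫ e, ‖F h e - F (i j) e‖ ∂π < η := by
  have : Fact ((1 : ℝ≥0∞) ≠ ∞) := ⟨by simp⟩
  have : SecondCountableTopology (Lp V 1 π) := inferInstance
  let S : Set (Lp V 1 π) := Set.range fun h => (hF h).toL1 (F h)
  have : Nonempty S := (Set.range_nonempty _).to_subtype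
  obtain ⟨u, hu⟩ := TopologicalSpace.exists_dense_seq S
  choose i hi using fun n => (u n).2
  refine ⟨i, fun h => ?_⟩
  obtain ⟨j, hj⟩ := hu.exists_dist_lt ⟨(hF h).toL1 (F h), h, rfl⟩ hη
  refine ⟨j, ?_⟩
  rw [Subtype.dist_eq, ← hi j, dist_eq_norm, ← Integrable.toL1_sub,
    L1.norm_of_fun_eq_integral_norm] at hj
  exact hj

/-- A bounded jointly measurable family of functions has a countable subfamily that is dense
in `L¹`. -/
theorem exists_seq_integral_norm_sub_lt_of_measurable {H E V : Type*} [Nonempty H]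
    [mH : MeasurableSpace H] [mE : MeasurableSpace E] [NormedAddCommGroup V]
    [SecondCountableTopology V] [mV : MeasurableSpace V] [BorelSpace V]
    (π : Measure E) [IsFiniteMeasure π] (F : H → E → V) (hF : Measurable (Function.uncurry F))
    {B : ℝ} (hB : ∀ h e, ‖F h e‖ ≤ B) {η : ℝ} (hη : 0 < η) :
    ∃ i : ℕ → H, ∀ h, ∃ j, ∫ e, ‖F h e - F (i j) e‖ ∂π < η := by
  obtain ⟨m', hm, hcg, hF'⟩ := exists_countablyGenerated_measurable_prod hF
  have hsec : ∀ h, @StronglyMeasurable _ _ _ m' (F h) := fun h =>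
    (@Measurable.comp _ _ _ m' (mH.prod m') _ _ _ hF'
      (@measurable_prodMk_left _ _ mH m' h)).stronglyMeasurable
  have hfin : @IsFiniteMeasure E m' (π.trim hm) := isFiniteMeasure_trim hm
  obtain ⟨i, hi⟩ := @exists_seq_integral_norm_sub_lt H E V _ m' hcg _ _ (π.trim hm) hfin F
    (fun h => Integrable.of_bound (hsec h).aestronglyMeasurable B
      (Filter.Eventually.of_forall (hB h))) η hη
  refine ⟨i, fun h => ?_⟩
  obtain ⟨j, hj⟩ := hi h
  refine ⟨j, ?_⟩
  exact (integral_trim hm ((hsec h).sub (hsec (i j))).norm).trans_lt hj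

/-- The standing assumptions on the transition density (bounded by `C`) and the one-stage cost
(bounded by `cb`). -/
structure IsModel {X Y A : Type u} [MeasurableSpace X] [MeasurableSpace Y] [MeasurableSpace A]
    (lam : Measure X) (ν : Measure Y) (q : X → Y → X → Y → A → ℝ) (c : X → Y → A → ℝ)
    (C cb : ℝ) : Prop where
  measurable_density :
    Measurable fun p : X × Y × X × Y × A => q p.1 p.2.1 p.2.2.1 p.2.2.2.1 p.2.2.2.2
  density_nonneg : ∀ x' y' x y a, 0 ≤ q x' y' x y a
  density_le : ∀ x' y' x y a, q x' y' x y a ≤ C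
  lintegral_density :
    ∀ x y a, ∫⁻ p : X × Y, ENNReal.ofReal (q p.1 p.2 x y a) ∂(lam.prod ν) = 1
  measurable_cost : Measurable fun p : X × Y × A => c p.1 p.2.1 p.2.2
  cost_nonneg : ∀ x y a, 0 ≤ c x y a
  cost_le : ∀ x y a, c x y a ≤ cb

/-- Expected terminal utility of the history-dependent policy `g` with `n` stages to go, given
the observable history `h` at time `k`, the hidden state `y` and the accumulated cost `s`. -/
noncomputable def condValue {X Y A : Type u} [MeasurableSpace X] [MeasurableSpace Y]
    (lam : Measure X) (ν : Measure Y) (q : X → Y → X → Y → A → ℝ) (c : X → Y → A → ℝ)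
    (U : ℝ → ℝ) (β : ℝ) (g : ∀ k, Hist X A k → A) :
    (n k : ℕ) → Hist X A k → Y → ℝ → ℝ
  | 0, _, _, _, s => U s
  | n + 1, k, h, y, s =>
      ∫ p : X × Y,
        condValue lam ν q c U β g n (k + 1) (h, g k h, p.1) p.2
            (s + β ^ k * c (lastObs k h) y (g k h))
          * q p.1 p.2 (lastObs k h) y (g k h) ∂(lam.prod ν)

theorem measurable_histSnoc {X A : Type u} {T : Type*} [MeasurableSpace X] [MeasurableSpace A]
    [MeasurableSpace T] {k : ℕ} {h : T → Hist X A k} {a : T → A} {x : T → X}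
    (hh : Measurable h) (ha : Measurable a) (hx : Measurable x) :
    Measurable (β := Hist X A (k + 1)) fun t => (h t, a t, x t) :=
  have hp : Measurable fun t => ((h t, a t, x t) : Hist X A k × A × X) :=
    hh.prodMk (ha.prodMk hx)
  hp

theorem measurable_lastObs {X A : Type u} [MeasurableSpace X] [MeasurableSpace A] :
    ∀ k, Measurable (lastObs k : Hist X A k → X)
  | 0 => measurable_id
  | n + 1 => (measurable_snd.comp measurable_snd :
      Measurable fun h : Hist X A n × A × X => h.2.2)

namespace IsModel

variable {X Y A : Type u} [MeasurableSpace X] [MeasurableSpace Y] [MeasurableSpace A]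
  {lam : Measure X} {ν : Measure Y} {q : X → Y → X → Y → A → ℝ} {c : X → Y → A → ℝ} {C cb : ℝ}

theorem measurable_density_comp (hm : IsModel lam ν q c C cb) {T : Type*} [MeasurableSpace T]
    {x' x : T → X} {y' y : T → Y} {a : T → A} (hx' : Measurable x') (hy' : Measurable y')
    (hx : Measurable x) (hy : Measurable y) (ha : Measurable a) :
    Measurable fun t => q (x' t) (y' t) (x t) (y t) (a t) :=
  hm.measurable_density.comp
    (hx'.prodMk (hy'.prodMk (hx.prodMk (hy.prodMk ha))))

theorem measurable_cost_comp (hm : IsModel lam ν q c C cb) {T : Type*} [MeasurableSpace T]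
    {x : T → X} {y : T → Y} {a : T → A}
    (hx : Measurable x) (hy : Measurable y) (ha : Measurable a) :
    Measurable fun t => c (x t) (y t) (a t) :=
  hm.measurable_cost.comp (hx.prodMk (hy.prodMk ha))

theorem integrable_density (hm : IsModel lam ν q c C cb) (x : X) (y : Y) (a : A) :
    Integrable (fun p : X × Y => q p.1 p.2 x y a) (lam.prod ν) := by
  refine ⟨(hm.measurable_density_comp measurable_fst measurable_snd measurable_const
    measurable_const measurable_const).aestronglyMeasurable, ?_⟩
  rw [hasFiniteIntegral_iff_ofReal (Filter.Eventually.of_forall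
    fun p => hm.density_nonneg _ _ _ _ _), hm.lintegral_density]
  exact ENNReal.one_lt_top

theorem integral_density (hm : IsModel lam ν q c C cb) (x : X) (y : Y) (a : A) :
    ∫ p : X × Y, q p.1 p.2 x y a ∂(lam.prod ν) = 1 := by
  rw [integral_eq_lintegral_of_nonneg_ae (Filter.Eventually.of_forall
    fun p => hm.density_nonneg _ _ _ _ _) (hm.integrable_density x y a).aestronglyMeasurable,
    hm.lintegral_density, ENNReal.toReal_one]

theorem integrable_mul_density (hm : IsModel lam ν q c C cb) (x : X) (y : Y) (a : A)
    {φ : X × Y → ℝ} (hφ : Measurable φ) {B : ℝ} (hB : ∀ p, |φ p| ≤ B) :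
    Integrable (fun p : X × Y => φ p * q p.1 p.2 x y a) (lam.prod ν) :=
  (hm.integrable_density x y a).bdd_mul hφ.aestronglyMeasurable (c := B)
    (Filter.Eventually.of_forall hB)

theorem abs_integral_mul_density_le (hm : IsModel lam ν q c C cb) (x : X) (y : Y) (a : A)
    {φ : X × Y → ℝ} {B : ℝ} (hB : ∀ p, |φ p| ≤ B) :
    |∫ p : X × Y, φ p * q p.1 p.2 x y a ∂(lam.prod ν)| ≤ B := by
  have h := norm_integral_le_of_norm_le ((hm.integrable_density x y a).const_mul B)
    (f := fun p : X × Y => φ p * q p.1 p.2 x y a) (Filter.Eventually.of_forall fun p => by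
      rw [norm_mul, Real.norm_of_nonneg (hm.density_nonneg _ _ _ _ _)]
      exact mul_le_mul_of_nonneg_right (hB p) (hm.density_nonneg _ _ _ _ _))
  rwa [integral_const_mul, hm.integral_density, mul_one] at h

theorem one_le_densityBound [IsProbabilityMeasure lam] [IsProbabilityMeasure ν]
    (hm : IsModel lam ν q c C cb) (x : X) (y : Y) (a : A) : 1 ≤ C := by
  have h := integral_mono (hm.integrable_density x y a) (integrable_const C)
    (fun p => hm.density_le p.1 p.2 x y a)
  simpa [hm.integral_density] using h

variable {U : ℝ → ℝ} {β B : ℝ}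

theorem abs_condValue_le (hm : IsModel lam ν q c C cb) (hB : ∀ s, |U s| ≤ B)
    (g : ∀ k, Hist X A k → A) (n k : ℕ) (h : Hist X A k) (y : Y) (s : ℝ) :
    |condValue lam ν q c U β g n k h y s| ≤ B := by
  induction n generalizing k h y s with
  | zero => exact hB s
  | succ n ih => exact hm.abs_integral_mul_density_le _ _ _ fun p => ih _ _ _ _

theorem measurable_condValue [IsProbabilityMeasure lam] [IsProbabilityMeasure ν]
    (hm : IsModel lam ν q c C cb) (hU : Measurable U)
    {g : ∀ k, Hist X A k → A} (hg : ∀ k, Measurable (g k)) (n k : ℕ) :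
    Measurable fun t : Hist X A k × Y × ℝ => condValue lam ν q c U β g n k t.1 t.2.1 t.2.2 := by
  induction n generalizing k with
  | zero => exact hU.comp (measurable_snd.comp measurable_snd)
  | succ n ih =>
    refine (StronglyMeasurable.integral_prod_right' (ν := lam.prod ν)
      (f := fun t : (Hist X A k × Y × ℝ) × (X × Y) =>
        condValue lam ν q c U β g n (k + 1) (t.1.1, g k t.1.1, t.2.1) t.2.2
            (t.1.2.2 + β ^ k * c (lastObs k t.1.1) t.1.2.1 (g k t.1.1))
          * q t.2.1 t.2.2 (lastObs k t.1.1) t.1.2.1 (g k t.1.1)) ?_).measurable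
    have hh : Measurable fun t : (Hist X A k × Y × ℝ) × (X × Y) => t.1.1 := by fun_prop
    have hx := (measurable_lastObs k).comp hh
    have hy : Measurable fun t : (Hist X A k × Y × ℝ) × (X × Y) => t.1.2.1 := by fun_prop
    have ha := (hg k).comp hh
    refine Measurable.stronglyMeasurable (Measurable.mul ?_ ?_)
    · have hs : Measurable fun t : (Hist X A k × Y × ℝ) × (X × Y) => t.1.2.2 := by fun_prop
      exact (ih (k + 1)).comp ((measurable_histSnoc hh ha (measurable_fst.comp measurable_snd)).prodMk
        ((measurable_snd.comp measurable_snd).prodMk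
          (hs.add ((hm.measurable_cost_comp hx hy ha).const_mul (β ^ k)))))
    · exact hm.measurable_density_comp (by fun_prop) (by fun_prop) hx hy ha

end IsModel

theorem measurable_lastX {X Y : Type u} [MeasurableSpace X] [MeasurableSpace Y] :
    ∀ k, Measurable (lastX k : Path X Y k → X)
  | 0 => (measurable_fst : Measurable fun p : X × Y => p.1)
  | n + 1 => (measurable_fst.comp measurable_snd :
      Measurable fun p : Path X Y n × (X × Y) => p.2.1)

theorem measurable_lastY {X Y : Type u} [MeasurableSpace X] [MeasurableSpace Y] :
    ∀ k, Measurable (lastY k : Path X Y k → Y)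
  | 0 => (measurable_snd : Measurable fun p : X × Y => p.2)
  | n + 1 => (measurable_snd.comp measurable_snd :
      Measurable fun p : Path X Y n × (X × Y) => p.2.2)

theorem measurable_pathInit {X Y : Type u} [MeasurableSpace X] [MeasurableSpace Y] (n : ℕ) :
    Measurable (α := Path X Y (n + 1)) (β := Path X Y n) fun p => p.1 :=
  (measurable_fst : Measurable fun p : Path X Y n × (X × Y) => p.1)

theorem measurable_obsHist {X Y A : Type u} [MeasurableSpace X] [MeasurableSpace Y]
    [MeasurableSpace A] {g : ∀ k, Hist X A k → A} (hg : ∀ k, Measurable (g k)) :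
    ∀ k, Measurable (obsHist g k : Path X Y k → Hist X A k)
  | 0 => measurable_lastX 0
  | n + 1 =>
    have h := (measurable_obsHist hg n).comp (measurable_pathInit n)
    measurable_histSnoc h ((hg n).comp h) (measurable_lastX (n + 1))

theorem lastObs_obsHist {X Y A : Type u} (g : ∀ k, Hist X A k → A) :
    ∀ k (p : Path X Y k), lastObs k (obsHist g k p) = lastX k p
  | 0, _ => rfl
  | _ + 1, _ => rfl

namespace IsModel

open ProbabilityTheory

variable {X Y A : Type u} [MeasurableSpace X] [MeasurableSpace Y] [MeasurableSpace A]
  {lam : Measure X} {ν : Measure Y} {q : X → Y → X → Y → A → ℝ} {c : X → Y → A → ℝ} {C cb : ℝ}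

theorem measurable_Scost (hm : IsModel lam ν q c C cb) (β : ℝ) {g : ∀ k, Hist X A k → A}
    (hg : ∀ k, Measurable (g k)) : ∀ k, Measurable (Scost (Y := Y) c β g k)
  | 0 => measurable_const
  | n + 1 =>
    (hm.measurable_Scost β hg n).comp (measurable_pathInit n) |>.add
      ((hm.measurable_cost_comp ((measurable_lastX n).comp (measurable_pathInit n))
        ((measurable_lastY n).comp (measurable_pathInit n))
        ((hg n).comp ((measurable_obsHist hg n).comp (measurable_pathInit n)))).const_mul _)

/-- The transition kernel of the controlled process under the policy `g`. -/
noncomputable def pathKernel (lam : Measure X) (ν : Measure Y) [SFinite lam] [SFinite ν]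
    (q : X → Y → X → Y → A → ℝ) (g : ∀ k, Hist X A k → A) (k : ℕ) :
    Kernel (Path X Y k) (X × Y) :=
  Kernel.withDensity (Kernel.const _ (lam.prod ν)) fun p p' =>
    ENNReal.ofReal (q p'.1 p'.2 (lastX k p) (lastY k p) (g k (obsHist g k p)))

theorem pathKernel_apply [SFinite lam] [SFinite ν] (hm : IsModel lam ν q c C cb)
    {g : ∀ k, Hist X A k → A} (hg : ∀ k, Measurable (g k)) (k : ℕ) (p : Path X Y k) :
    pathKernel lam ν q g k p = (lam.prod ν).withDensity fun p' =>
      ENNReal.ofReal (q p'.1 p'.2 (lastX k p) (lastY k p) (g k (obsHist g k p))) := by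
  have hp : Measurable fun t : Path X Y k × (X × Y) => t.1 := measurable_fst
  exact Kernel.withDensity_apply _ (hm.measurable_density_comp
    (measurable_fst.comp measurable_snd) (measurable_snd.comp measurable_snd)
    ((measurable_lastX k).comp hp) ((measurable_lastY k).comp hp)
    ((hg k).comp ((measurable_obsHist hg k).comp hp))).ennreal_ofReal p

theorem isMarkovKernel_pathKernel [SFinite lam] [SFinite ν] (hm : IsModel lam ν q c C cb)
    {g : ∀ k, Hist X A k → A} (hg : ∀ k, Measurable (g k)) (k : ℕ) :
    IsMarkovKernel (pathKernel lam ν q g k) :=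
  ⟨fun p => ⟨by rw [hm.pathKernel_apply hg, withDensity_apply _ MeasurableSet.univ,
    Measure.restrict_univ, hm.lintegral_density]⟩⟩

theorem pathLaw_succ [SFinite lam] [SFinite ν] (hm : IsModel lam ν q c C cb)
    {g : ∀ k, Hist X A k → A} (hg : ∀ k, Measurable (g k)) (Q0Y : Measure Y) (x : X) (k : ℕ)
    [SFinite (pathLaw lam ν Q0Y q g x k)] :
    pathLaw lam ν Q0Y q g x (k + 1)
      = pathLaw lam ν Q0Y q g x k ⊗ₘ pathKernel lam ν q g k := by
  have := hm.isMarkovKernel_pathKernel hg k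
  rw [Measure.compProd_eq_comp_prod]
  change (pathLaw lam ν Q0Y q g x k).bind _ = (pathLaw lam ν Q0Y q g x k).bind _
  congr 1
  funext p
  rw [Kernel.prod_apply, Kernel.id_apply, hm.pathKernel_apply hg]

theorem isProbabilityMeasure_pathLaw [SFinite lam] [SFinite ν] (hm : IsModel lam ν q c C cb)
    {g : ∀ k, Hist X A k → A} (hg : ∀ k, Measurable (g k)) (Q0Y : Measure Y)
    [IsProbabilityMeasure Q0Y] (x : X) (k : ℕ) :
    IsProbabilityMeasure (pathLaw lam ν Q0Y q g x k) := by
  induction k with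
  | zero => exact inferInstanceAs (IsProbabilityMeasure ((Measure.dirac x).prod Q0Y))
  | succ k ih =>
    have := hm.isMarkovKernel_pathKernel hg k
    rw [hm.pathLaw_succ hg]
    exact inferInstanceAs (IsProbabilityMeasure
      (pathLaw lam ν Q0Y q g x k ⊗ₘ pathKernel lam ν q g k))

variable [IsProbabilityMeasure lam] [IsProbabilityMeasure ν] {U : ℝ → ℝ} {β B : ℝ}

theorem integral_condValue_pathLaw_succ (hm : IsModel lam ν q c C cb) (hU : Measurable U)
    (hB : ∀ s, |U s| ≤ B) {g : ∀ k, Hist X A k → A} (hg : ∀ k, Measurable (g k))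
    (Q0Y : Measure Y) [IsProbabilityMeasure Q0Y] (x : X) (n k : ℕ) :
    ∫ p, condValue lam ν q c U β g n (k + 1) (obsHist g (k + 1) p) (lastY (k + 1) p)
        (Scost c β g (k + 1) p) ∂(pathLaw lam ν Q0Y q g x (k + 1))
      = ∫ p, condValue lam ν q c U β g (n + 1) k (obsHist g k p) (lastY k p)
        (Scost c β g k p) ∂(pathLaw lam ν Q0Y q g x k) := by
  have := hm.isMarkovKernel_pathKernel hg k
  have := hm.isProbabilityMeasure_pathLaw hg Q0Y x k
  rw [hm.pathLaw_succ hg]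
  have hmeas : Measurable (α := Path X Y (k + 1)) fun p =>
      condValue lam ν q c U β g n (k + 1) (obsHist g (k + 1) p) (lastY (k + 1) p)
        (Scost c β g (k + 1) p) :=
    (hm.measurable_condValue hU hg n (k + 1)).comp ((measurable_obsHist hg (k + 1)).prodMk
      ((measurable_lastY (k + 1)).prodMk (hm.measurable_Scost β hg (k + 1))))
  refine (Measure.integral_compProd (f := fun p : Path X Y k × (X × Y) =>
    condValue lam ν q c U β g n (k + 1) (obsHist g (k + 1) p) (lastY (k + 1) p)
        (Scost c β g (k + 1) p)) (Integrable.of_bound hmeas.aestronglyMeasurable B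
    (Filter.Eventually.of_forall fun p => hm.abs_condValue_le hB g _ _ _ _ _))).trans ?_
  refine integral_congr_ae (Filter.Eventually.of_forall fun p => ?_)
  simp only []
  rw [hm.pathKernel_apply hg, integral_withDensity_eq_integral_toReal_smul
    (hm.measurable_density_comp (by fun_prop) (by fun_prop) (by fun_prop) (by fun_prop)
      (by fun_prop)).ennreal_ofReal (Filter.Eventually.of_forall fun _ => ENNReal.ofReal_lt_top)]
  refine integral_congr_ae (Filter.Eventually.of_forall fun p' => ?_)
  simp only [ENNReal.toReal_ofReal (hm.density_nonneg _ _ _ _ _), smul_eq_mul,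
    lastObs_obsHist]
  exact mul_comm _ _

theorem Jpol_add_eq_integral_condValue (hm : IsModel lam ν q c C cb) (hU : Measurable U)
    (hB : ∀ s, |U s| ≤ B) {g : ∀ k, Hist X A k → A} (hg : ∀ k, Measurable (g k))
    (Q0Y : Measure Y) [IsProbabilityMeasure Q0Y] (x : X) (n k : ℕ) :
    Jpol lam ν Q0Y q c U β g (k + n) x
      = ∫ p, condValue lam ν q c U β g n k (obsHist g k p) (lastY k p)
        (Scost c β g k p) ∂(pathLaw lam ν Q0Y q g x k) := by
  induction n generalizing k with
  | zero => rfl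
  | succ n ih =>
    rw [← hm.integral_condValue_pathLaw_succ hU hB hg, ← ih, Nat.add_right_comm, Nat.add_assoc]

theorem Jpol_eq_integral_condValue (hm : IsModel lam ν q c C cb) (hU : Measurable U)
    (hB : ∀ s, |U s| ≤ B) {g : ∀ k, Hist X A k → A} (hg : ∀ k, Measurable (g k))
    (Q0Y : Measure Y) [IsProbabilityMeasure Q0Y] (x : X) (N : ℕ) :
    Jpol lam ν Q0Y q c U β g N x
      = ∫ ys : Y × ℝ, condValue lam ν q c U β g N 0 x ys.1 ys.2
          ∂(Q0Y.prod (Measure.dirac (0 : ℝ))) := by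
  have h := hm.Jpol_add_eq_integral_condValue (β := β) hU hB hg Q0Y x N 0
  rw [Nat.zero_add] at h
  have hx : Measurable (β := Hist X A 0) fun p : X × Y => p.1 := measurable_fst
  have hxc : Measurable (β := Hist X A 0) fun _ : Y × ℝ => x := measurable_const
  have hmeas := hm.measurable_condValue (β := β) hU hg N 0
  have hl : ∫ p : X × Y, condValue lam ν q c U β g N 0 p.1 p.2 0 ∂((Measure.dirac x).prod Q0Y)
      = ∫ y, condValue lam ν q c U β g N 0 x y 0 ∂Q0Y := by
    rw [Measure.dirac_prod]
    exact integral_map measurable_prodMk_left.aemeasurable (hmeas.comp (hx.prodMk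
      (measurable_snd.prodMk measurable_const))).aestronglyMeasurable
  have hr : ∫ ys : Y × ℝ, condValue lam ν q c U β g N 0 x ys.1 ys.2
      ∂(Q0Y.prod (Measure.dirac (0 : ℝ))) = ∫ y, condValue lam ν q c U β g N 0 x y 0 ∂Q0Y := by
    rw [Measure.prod_dirac]
    exact integral_map measurable_prodMk_right.aemeasurable (hmeas.comp (hxc.prodMk
      (measurable_fst.prodMk measurable_snd))).aestronglyMeasurable
  exact h.trans (hl.trans hr.symm)

end IsModel

namespace IsModel

open ProbabilityTheory

variable {X Y A : Type u} [MeasurableSpace X] [MeasurableSpace Y] [MeasurableSpace A]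
  {lam : Measure X} {ν : Measure Y} {q : X → Y → X → Y → A → ℝ} {c : X → Y → A → ℝ} {C cb : ℝ}

theorem measurable_updateMap (hm : IsModel lam ν q c C cb) (x : X) (a : A) (z : ℝ) :
    Measurable fun p : (Y × ℝ) × Y => (p.2, p.1.2 + z * c x p.1.1 a) :=
  measurable_snd.prodMk ((measurable_snd.comp measurable_fst).add
    ((hm.measurable_cost_comp measurable_const (measurable_fst.comp measurable_fst)
      measurable_const).const_mul z))

theorem integral_Psi (hm : IsModel lam ν q c C cb) (x : X) (a : A) (x' : X)
    (μ : Measure (Y × ℝ)) (z : ℝ) {φ : Y × ℝ → ℝ} (hφ : Measurable φ) :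
    ∫ w, φ w ∂(Psi q c ν x a x' μ z)
      = ∫ p : (Y × ℝ) × Y, φ (p.2, p.1.2 + z * c x p.1.1 a) * q x' p.2 x p.1.1 a
          ∂(μ.prod ν) := by
  rw [Psi, integral_map (hm.measurable_updateMap _ _ _).aemeasurable hφ.aestronglyMeasurable,
    integral_withDensity_eq_integral_toReal_smul
      (hm.measurable_density_comp (by fun_prop) (by fun_prop) (by fun_prop) (by fun_prop)
      (by fun_prop)).ennreal_ofReal (Filter.Eventually.of_forall fun _ => ENNReal.ofReal_lt_top)]
  refine integral_congr_ae (Filter.Eventually.of_forall fun p => ?_)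
  simp only [ENNReal.toReal_ofReal (hm.density_nonneg _ _ _ _ _), smul_eq_mul]
  exact mul_comm _ _

variable [IsProbabilityMeasure ν]

theorem measurable_Psi (hm : IsModel lam ν q c C cb) {T : Type*} [MeasurableSpace T]
    {x x' : T → X} {a : T → A} (hx : Measurable x) (ha : Measurable a) (hx' : Measurable x')
    (κ : Kernel T (Y × ℝ)) [IsSFiniteKernel κ] (z : ℝ) :
    Measurable fun t => Psi q c ν (x t) (a t) (x' t) (κ t) z := by
  refine Measure.measurable_of_measurable_coe _ fun s hs => ?_
  let S : Set (T × ((Y × ℝ) × Y)) :=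
    {p | (p.2.2, p.2.1.2 + z * c (x p.1) p.2.1.1 (a p.1)) ∈ s}
  have hS : MeasurableSet S := by
    refine Measurable.prodMk (by fun_prop) (Measurable.add (by fun_prop) ?_) hs
    exact (hm.measurable_cost_comp (hx.comp measurable_fst) (by fun_prop)
      (ha.comp measurable_fst)).const_mul z
  have hq : Measurable fun p : T × ((Y × ℝ) × Y) =>
      ENNReal.ofReal (q (x' p.1) p.2.2 (x p.1) p.2.1.1 (a p.1)) :=
    (hm.measurable_density_comp (hx'.comp measurable_fst) (by fun_prop) (hx.comp measurable_fst)
      (by fun_prop) (ha.comp measurable_fst)).ennreal_ofReal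
  have key := Measurable.lintegral_kernel_prod_right (κ := κ ×ₖ Kernel.const T ν)
    (f := fun t w => S.indicator (fun p : T × ((Y × ℝ) × Y) =>
      ENNReal.ofReal (q (x' p.1) p.2.2 (x p.1) p.2.1.1 (a p.1))) (t, w)) (hq.indicator hS)
  refine (congrArg Measurable (funext fun t => ?_)).mp key
  have hpre := hm.measurable_updateMap (x t) (a t) z hs
  rw [Psi, Measure.map_apply (hm.measurable_updateMap _ _ _) hs, withDensity_apply _ hpre,
    ← lintegral_indicator hpre, Kernel.prod_apply, Kernel.const_apply]
  rfl

theorem Psi_univ_le (hm : IsModel lam ν q c C cb) (x : X) (a : A) (x' : X)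
    (μ : Measure (Y × ℝ)) [SFinite μ] (z : ℝ) :
    Psi q c ν x a x' μ z Set.univ ≤ ENNReal.ofReal C * μ Set.univ := by
  rw [Psi, Measure.map_apply (hm.measurable_updateMap _ _ _) MeasurableSet.univ,
    Set.preimage_univ, withDensity_apply _ MeasurableSet.univ, Measure.restrict_univ]
  refine (lintegral_mono fun p => ENNReal.ofReal_le_ofReal (hm.density_le _ _ _ _ _)).trans ?_
  rw [lintegral_const, Measure.prod_apply MeasurableSet.univ]
  simp

theorem measurable_infoState_and_univ_le (hm : IsModel lam ν q c C cb) (Q0Y : Measure Y)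
    [IsProbabilityMeasure Q0Y] (β : ℝ) (k : ℕ) :
    Measurable (infoState (X := X) (A := A) ν Q0Y q c β k) ∧
      ∀ h : Hist X A k, infoState ν Q0Y q c β k h Set.univ ≤ ENNReal.ofReal C ^ k := by
  induction k with
  | zero => exact ⟨measurable_const, fun h => by simp [infoState]⟩
  | succ k ih =>
    let κ : Kernel (Hist X A k) (Y × ℝ) := ⟨infoState ν Q0Y q c β k, ih.1⟩
    have : IsFiniteKernel κ :=
      ⟨ENNReal.ofReal C ^ k, ENNReal.pow_lt_top ENNReal.ofReal_lt_top, ih.2⟩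
    have hfst : Measurable fun p : Hist X A k × A × X => p.1 := measurable_fst
    constructor
    · exact hm.measurable_Psi (T := Hist X A k × A × X) ((measurable_lastObs k).comp hfst)
        (measurable_fst.comp measurable_snd) (measurable_snd.comp measurable_snd)
        (κ.comap _ hfst) (β ^ k)
    · intro h
      have : IsFiniteMeasure (infoState ν Q0Y q c β k h.1) :=
        ⟨(ih.2 h.1).trans_lt (ENNReal.pow_lt_top ENNReal.ofReal_lt_top)⟩
      refine (hm.Psi_univ_le _ _ _ _ _).trans ?_
      rw [pow_succ']
      exact mul_le_mul_right (ih.2 h.1) _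

theorem isFiniteMeasure_infoState (hm : IsModel lam ν q c C cb) (Q0Y : Measure Y)
    [IsProbabilityMeasure Q0Y] (β : ℝ) (k : ℕ) (h : Hist X A k) :
    IsFiniteMeasure (infoState ν Q0Y q c β k h) :=
  ⟨((hm.measurable_infoState_and_univ_le Q0Y β k).2 h).trans_lt
    (ENNReal.pow_lt_top ENNReal.ofReal_lt_top)⟩

variable [IsProbabilityMeasure lam]

theorem integral_integral_Psi (hm : IsModel lam ν q c C cb) (x : X) (a : A)
    (μ : Measure (Y × ℝ)) [IsFiniteMeasure μ] (z : ℝ) {φ : X → Y × ℝ → ℝ}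
    (hφ : Measurable (Function.uncurry φ)) {B : ℝ} (hB : ∀ x w, |φ x w| ≤ B) :
    Integrable (fun x' => ∫ w, φ x' w ∂(Psi q c ν x a x' μ z)) lam ∧
    ∫ x', ∫ w, φ x' w ∂(Psi q c ν x a x' μ z) ∂lam
      = ∫ ys : Y × ℝ, ∫ p : X × Y, φ p.1 (p.2, ys.2 + z * c x ys.1 a) * q p.1 p.2 x ys.1 a
          ∂(lam.prod ν) ∂μ := by
  let F : X × ((Y × ℝ) × Y) → ℝ := fun p =>
    φ p.1 (p.2.2, p.2.1.2 + z * c x p.2.1.1 a) * q p.1 p.2.2 x p.2.1.1 a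
  have hF : Measurable F := by
    refine Measurable.mul ?_ ?_
    · exact hφ.comp (measurable_fst.prodMk
        ((hm.measurable_updateMap x a z).comp measurable_snd))
    · exact hm.measurable_density_comp (by fun_prop) (by fun_prop) (by fun_prop) (by fun_prop)
        (by fun_prop)
  have hFB : ∀ p, ‖F p‖ ≤ B * C := fun p => by
    rw [norm_mul]
    refine mul_le_mul (hB _ _) ?_ (norm_nonneg _) ((abs_nonneg _).trans (hB x p.2.1))
    rw [Real.norm_of_nonneg (hm.density_nonneg _ _ _ _ _)]
    exact hm.density_le _ _ _ _ _
  have hint : Integrable F (lam.prod (μ.prod ν)) :=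
    Integrable.of_bound hF.aestronglyMeasurable _ (Filter.Eventually.of_forall hFB)
  have hP : ∀ x', ∫ w, φ x' w ∂(Psi q c ν x a x' μ z) = ∫ p, F (x', p) ∂(μ.prod ν) :=
    fun x' => hm.integral_Psi x a x' μ z (hφ.comp measurable_prodMk_left)
  simp_rw [hP]
  refine ⟨hint.integral_prod_left, ?_⟩
  have h1 : ∀ x', ∫ p, F (x', p) ∂(μ.prod ν) = ∫ ys, ∫ y', F (x', ys, y') ∂ν ∂μ := fun x' =>
    integral_prod _ (Integrable.of_bound (hF.comp measurable_prodMk_left).aestronglyMeasurable _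
      (Filter.Eventually.of_forall fun p => hFB _))
  have h2 : ∀ ys : Y × ℝ, ∫ p : X × Y, F (p.1, ys, p.2) ∂(lam.prod ν)
      = ∫ x', ∫ y', F (x', ys, y') ∂ν ∂lam := fun ys =>
    integral_prod _ (Integrable.of_bound
      (hF.comp (g := F) (f := fun p : X × Y => (p.1, ys, p.2)) (by fun_prop)).aestronglyMeasurable _
      (Filter.Eventually.of_forall fun p => hFB _))
  simp_rw [h1]
  rw [integral_integral_swap]
  · exact integral_congr_ae (Filter.Eventually.of_forall fun ys => (h2 ys).symm)
  · have hG : Measurable fun t : (X × (Y × ℝ)) × Y => F (t.1.1, t.1.2, t.2) :=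
      hF.comp (by fun_prop)
    refine Integrable.of_bound
      (StronglyMeasurable.integral_prod_right' hG.stronglyMeasurable).aestronglyMeasurable
      (B * C) (Filter.Eventually.of_forall fun p => ?_)
    have := norm_integral_le_of_norm_le_const (μ := ν)
      (Filter.Eventually.of_forall fun y' => hFB (p.1, p.2, y'))
    rw [probReal_univ, mul_one] at this
    exact this

end IsModel

/-- The history-dependent policy that follows the Markov policy `f` of the information-state
MDP along the information states. -/
noncomputable def inducedPolicy {X Y A : Type u} [MeasurableSpace X] [MeasurableSpace Y]
    (ν : Measure Y) (Q0Y : Measure Y) (q : X → Y → X → Y → A → ℝ) (c : X → Y → A → ℝ)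
    (β : ℝ) (f : ℕ → IS X Y → A) : ∀ k, Hist X A k → A :=
  fun k h => f k (lastObs k h, infoState ν Q0Y q c β k h, β ^ k)

theorem condValue_inducedPolicy {X Y A : Type u} [MeasurableSpace X] [MeasurableSpace Y]
    (lam : Measure X) (ν : Measure Y) (Q0Y : Measure Y) (q : X → Y → X → Y → A → ℝ)
    (c : X → Y → A → ℝ) (U : ℝ → ℝ) (β : ℝ) (f : ℕ → IS X Y → A) (n k : ℕ) (h : Hist X A k)
    (y : Y) (s : ℝ) :
    condValue lam ν q c U β (inducedPolicy ν Q0Y q c β f) n k h y s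
      = Efun lam ν q c U β n (fun j => f (k + j)) (lastObs k h) y
          (infoState ν Q0Y q c β k h) (β ^ k) s := by
  induction n generalizing k h y s with
  | zero => rfl
  | succ n ih =>
    have hf : (fun j => f (k + (j + 1))) = fun j => f (k + 1 + j) :=
      funext fun j => congrArg f (by omega)
    refine integral_congr_ae (Filter.Eventually.of_forall fun p => ?_)
    refine congrArg (· * q p.1 p.2 (lastObs k h) y (inducedPolicy ν Q0Y q c β f k h))
      ((ih (k + 1) (h, inducedPolicy ν Q0Y q c β f k h, p.1) p.2 _).trans ?_)
    rw [← hf, pow_succ']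
    rfl

theorem IsModel.Jpol_inducedPolicy {X Y A : Type u} [MeasurableSpace X] [MeasurableSpace Y]
    [MeasurableSpace A] {lam : Measure X} {ν : Measure Y} [IsProbabilityMeasure lam]
    [IsProbabilityMeasure ν] {q : X → Y → X → Y → A → ℝ} {c : X → Y → A → ℝ} {C cb : ℝ}
    (hm : IsModel lam ν q c C cb) {U : ℝ → ℝ} (hU : Measurable U) {B : ℝ} (hB : ∀ s, |U s| ≤ B)
    (Q0Y : Measure Y) [IsProbabilityMeasure Q0Y] (β : ℝ) {f : ℕ → IS X Y → A}
    (hg : ∀ k, Measurable (inducedPolicy ν Q0Y q c β f k)) (N : ℕ) (x : X) :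
    Jpol lam ν Q0Y q c U β (inducedPolicy ν Q0Y q c β f) N x
      = Vnpi lam ν q c U β f N (x, Q0Y.prod (Measure.dirac (0 : ℝ)), 1) := by
  rw [hm.Jpol_eq_integral_condValue hU hB hg]
  refine integral_congr_ae (Filter.Eventually.of_forall fun ys => ?_)
  refine (condValue_inducedPolicy lam ν Q0Y q c U β f N 0 x ys.1 ys.2).trans ?_
  simp only [Nat.zero_add, pow_zero]
  rfl

theorem IsModel.measurable_inducedPolicy {X Y A : Type u} [MeasurableSpace X]
    [MeasurableSpace Y] [MeasurableSpace A] {lam : Measure X} {ν : Measure Y}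
    [IsProbabilityMeasure ν] {q : X → Y → X → Y → A → ℝ} {c : X → Y → A → ℝ} {C cb : ℝ}
    (hm : IsModel lam ν q c C cb) (Q0Y : Measure Y) [IsProbabilityMeasure Q0Y] (β : ℝ)
    {f : ℕ → IS X Y → A} (hf : ∀ k, Measurable (f k)) (k : ℕ) :
    Measurable (inducedPolicy ν Q0Y q c β f k) :=
  (hf k).comp ((measurable_lastObs k).prodMk
    ((hm.measurable_infoState_and_univ_le Q0Y β k).1.prodMk measurable_const))

theorem exists_measurable_argmin_approx {S : Type*} [MeasurableSpace S] {W : ℕ → S → ℝ}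
    (hW : ∀ i, Measurable (W i)) {b : ℝ} (hb : ∀ i s, b ≤ W i s) {δ : ℝ} (hδ : 0 < δ) :
    ∃ ι : S → ℕ, Measurable ι ∧ ∀ s j, W (ι s) s ≤ W j s + δ := by
  classical
  have hex : ∀ s, ∃ i, ∀ j, W i s ≤ W j s + δ := fun s => by
    have hbdd : BddBelow (Set.range fun i => W i s) := ⟨b, by rintro _ ⟨i, rfl⟩; exact hb i s⟩
    obtain ⟨i, hi⟩ := exists_lt_of_ciInf_lt (lt_add_of_pos_right (⨅ i, W i s) hδ)
    exact ⟨i, fun j => hi.le.trans (by gcongr; exact ciInf_le hbdd j)⟩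
  refine ⟨fun s => Nat.find (hex s), measurable_find hex fun i => ?_, fun s => Nat.find_spec (hex s)⟩
  simp only [Set.ofPred_forall]
  exact MeasurableSet.iInter fun j => measurableSet_le (hW i) ((hW j).add_const δ)

namespace IsModel

open ProbabilityTheory

variable {X Y A : Type u} [MeasurableSpace X] [MeasurableSpace Y] [MeasurableSpace A]
  {lam : Measure X} {ν : Measure Y} {q : X → Y → X → Y → A → ℝ} {c : X → Y → A → ℝ} {C cb : ℝ}
  [IsProbabilityMeasure lam] [IsProbabilityMeasure ν] {U : ℝ → ℝ} {β B : ℝ}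
  {g : ∀ k, Hist X A k → A}

theorem measurable_condValue_comp (hm : IsModel lam ν q c C cb) (hU : Measurable U)
    (hg : ∀ k, Measurable (g k)) (n k : ℕ) {T : Type*} [MeasurableSpace T]
    {h : T → Hist X A k} {y : T → Y} {s : T → ℝ} (hh : Measurable h) (hy : Measurable y)
    (hs : Measurable s) :
    Measurable fun t => condValue lam ν q c U β g n k (h t) (y t) (s t) :=
  (hm.measurable_condValue hU hg n k).comp (hh.prodMk (hy.prodMk hs))

theorem abs_condValue_sub_le (hm : IsModel lam ν q c C cb) (hU : Measurable U)
    (hB : ∀ s, |U s| ≤ B) (hβ0 : 0 ≤ β) (hβ1 : β ≤ 1) (hg : ∀ k, Measurable (g k))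
    {η : ℝ} (n k : ℕ) (h : Hist X A k) (y : Y) {s t : ℝ}
    (hst : ∀ a, 0 ≤ a → a ≤ n * cb → |U (s + a) - U (t + a)| ≤ η) :
    |condValue lam ν q c U β g n k h y s - condValue lam ν q c U β g n k h y t| ≤ η := by
  induction n generalizing k h y s t with
  | zero => simpa [condValue] using hst 0 le_rfl (by simp)
  | succ n ih =>
    have hint : ∀ r : ℝ, Integrable (fun p : X × Y =>
        condValue lam ν q c U β g n (k + 1) (h, g k h, p.1) p.2 r
          * q p.1 p.2 (lastObs k h) y (g k h)) (lam.prod ν) := fun r =>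
      hm.integrable_mul_density _ _ _
        (hm.measurable_condValue_comp hU hg n (k + 1)
          (measurable_histSnoc measurable_const measurable_const measurable_fst)
          measurable_snd measurable_const)
        (fun p => hm.abs_condValue_le hB g n (k + 1) _ _ _)
    simp only [condValue]
    rw [← integral_sub (hint _) (hint _)]
    simp_rw [← sub_mul]
    refine hm.abs_integral_mul_density_le _ _ _ fun p => ih _ _ _ fun a ha0 ha => ?_
    have hc0 := hm.cost_nonneg (lastObs k h) y (g k h)
    have hd : β ^ k * c (lastObs k h) y (g k h) ≤ cb :=
      (mul_le_of_le_one_left hc0 (pow_le_one₀ hβ0 hβ1)).trans (hm.cost_le _ _ _)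
    rw [add_assoc, add_assoc]
    refine hst _ (by positivity) ?_
    push_cast
    linarith

theorem exists_seq_prefix (hm : IsModel lam ν q c C cb) (hU : Measurable U)
    (hB : ∀ s, |U s| ≤ B) (hβ0 : 0 ≤ β) (hβ1 : β ≤ 1) (hg : ∀ k, Measurable (g k)) (n k : ℕ)
    [Nonempty (Hist X A k × A)] {η : ℝ} (hη : 0 < η) {T : Finset ℝ}
    (hT : ∀ s, ∃ t ∈ T, ∀ a, 0 ≤ a → a ≤ n * cb → |U (s + a) - U (t + a)| ≤ η) :
    ∃ e : ℕ → Hist X A k × A, ∀ (h : Hist X A k) (a : A), ∃ (j : ℕ) (D : X × Y → ℝ),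
      Measurable D ∧ (∀ p, 0 ≤ D p) ∧ (∀ p, D p ≤ 2 * B) ∧ ∫ p, D p ∂(lam.prod ν) ≤ η ∧
      ∀ x' y' s, condValue lam ν q c U β g n (k + 1) ((e j).1, (e j).2, x') y' s
        ≤ condValue lam ν q c U β g n (k + 1) (h, a, x') y' s + (D (x', y') + 2 * η) := by
  let F : Hist X A k × A → X × Y → (↥T → ℝ) := fun r p t =>
    condValue lam ν q c U β g n (k + 1) (r.1, r.2, p.1) p.2 t
  have hFm : Measurable (Function.uncurry F) := by
    refine measurable_pi_lambda _ fun t => ?_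
    exact hm.measurable_condValue_comp hU hg n (k + 1)
      (measurable_histSnoc (by fun_prop) (by fun_prop) (by fun_prop)) (by fun_prop)
      measurable_const
  have hB0 : 0 ≤ B := (abs_nonneg _).trans (hB 0)
  have hFB : ∀ r p, ‖F r p‖ ≤ B := fun r p =>
    (pi_norm_le_iff_of_nonneg hB0).2 fun t => hm.abs_condValue_le hB g n (k + 1) _ _ _
  obtain ⟨e, he⟩ := exists_seq_integral_norm_sub_lt_of_measurable (lam.prod ν) F hFm hFB hη
  refine ⟨e, fun h a => ?_⟩
  obtain ⟨j, hj⟩ := he (h, a)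
  have hsec : ∀ r, Measurable (F r) := fun r => hFm.comp measurable_prodMk_left
  refine ⟨j, fun p => ‖F (h, a) p - F (e j) p‖, ((hsec _).sub (hsec _)).norm,
    fun p => norm_nonneg _, fun p => ?_, hj.le, fun x' y' s => ?_⟩
  · refine (norm_sub_le _ _).trans ?_
    linarith [hFB (h, a) p, hFB (e j) p]
  · obtain ⟨t, htT, ht⟩ := hT s
    have h1 := hm.abs_condValue_sub_le hU hB hβ0 hβ1 hg n (k + 1) (h, a, x') y' ht
    have h2 := hm.abs_condValue_sub_le hU hB hβ0 hβ1 hg n (k + 1) ((e j).1, (e j).2, x') y' ht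
    have h3 := norm_le_pi_norm (F (h, a) (x', y') - F (e j) (x', y')) ⟨t, htT⟩
    rw [Pi.sub_apply, Real.norm_eq_abs] at h3
    have h1' := (abs_le.1 h1).1
    have h2' := (abs_le.1 h2).2
    have h3' := (abs_le.1 h3).1
    simp only [F] at h3' ⊢
    linarith

theorem integral_condValue_succ (hm : IsModel lam ν q c C cb) (hU : Measurable U)
    (hB : ∀ s, |U s| ≤ B) (hg : ∀ k, Measurable (g k)) (Q0Y : Measure Y)
    [IsProbabilityMeasure Q0Y] (n k : ℕ) (h : Hist X A k) :
    Integrable (fun x' => ∫ w, condValue lam ν q c U β g n (k + 1) (h, g k h, x') w.1 w.2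
      ∂(Psi q c ν (lastObs k h) (g k h) x' (infoState ν Q0Y q c β k h) (β ^ k))) lam ∧
    ∫ x', ∫ w, condValue lam ν q c U β g n (k + 1) (h, g k h, x') w.1 w.2
      ∂(Psi q c ν (lastObs k h) (g k h) x' (infoState ν Q0Y q c β k h) (β ^ k)) ∂lam
    = ∫ w, condValue lam ν q c U β g (n + 1) k h w.1 w.2 ∂(infoState ν Q0Y q c β k h) := by
  have := hm.isFiniteMeasure_infoState Q0Y β k h
  exact hm.integral_integral_Psi (lastObs k h) (g k h) (infoState ν Q0Y q c β k h) (β ^ k)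
    (φ := fun x' w => condValue lam ν q c U β g n (k + 1) (h, g k h, x') w.1 w.2)
    (hm.measurable_condValue_comp hU hg n (k + 1)
      (measurable_histSnoc measurable_const measurable_const measurable_fst) (by fun_prop)
      (by fun_prop))
    (fun x w => hm.abs_condValue_le hB g n (k + 1) _ _ _)

theorem integral_condValue_succ_le (hm : IsModel lam ν q c C cb) (hU : Measurable U)
    (hB : ∀ s, |U s| ≤ B) (hg : ∀ k, Measurable (g k)) {g' : ∀ k, Hist X A k → A}
    (hg' : ∀ k, Measurable (g' k)) (Q0Y : Measure Y) [IsProbabilityMeasure Q0Y] (n k : ℕ)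
    (h h' : Hist X A k) (hobs : lastObs k h = lastObs k h') (hact : g' k h = g k h')
    (hC : 0 ≤ C) {M : ℝ} (hM : (infoState ν Q0Y q c β k h).real Set.univ ≤ M) {η err : ℝ}
    (hη : 0 ≤ η) {D : X × Y → ℝ} (hD : Measurable D) (hD0 : ∀ p, 0 ≤ D p)
    (hDB : ∀ p, D p ≤ 2 * B) (hDη : ∫ p, D p ∂(lam.prod ν) ≤ η)
    (hnext : ∀ x', ∫ w, condValue lam ν q c U β g' n (k + 1) (h, g' k h, x') w.1 w.2
        ∂(infoState ν Q0Y q c β (k + 1) (h, g' k h, x'))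
      ≤ ∫ w, (condValue lam ν q c U β g n (k + 1) (h', g k h', x') w.1 w.2
          + (D (x', w.1) + 2 * η)) ∂(infoState ν Q0Y q c β (k + 1) (h, g' k h, x')) + err) :
    ∫ w, condValue lam ν q c U β g' (n + 1) k h w.1 w.2 ∂(infoState ν Q0Y q c β k h)
      ≤ ∫ w, condValue lam ν q c U β g (n + 1) k h' w.1 w.2 ∂(infoState ν Q0Y q c β k h)
        + M * ((C + 2) * η) + err := by
  have := hm.isFiniteMeasure_infoState Q0Y β k h
  set μ := infoState ν Q0Y q c β k h with hμ
  obtain ⟨hint', heq'⟩ := hm.integral_condValue_succ (β := β) hU hB hg' Q0Y n k h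
  let φ : X → Y × ℝ → ℝ := fun x' w =>
    condValue lam ν q c U β g n (k + 1) (h', g k h', x') w.1 w.2 + (D (x', w.1) + 2 * η)
  have hcv : Measurable (fun t : X × (Y × ℝ) =>
      condValue lam ν q c U β g n (k + 1) (h', g k h', t.1) t.2.1 t.2.2) :=
    hm.measurable_condValue_comp hU hg n (k + 1)
      (measurable_histSnoc measurable_const measurable_const measurable_fst) (by fun_prop)
      (by fun_prop)
  have hφ : Measurable (Function.uncurry φ) := hcv.add (by fun_prop)
  have hφB : ∀ x w, |φ x w| ≤ 3 * B + 2 * η := fun x w => by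
    have h1 := abs_le.1 (hm.abs_condValue_le (β := β) hB g n (k + 1) (h', g k h', x) w.1 w.2)
    have h2 := hD0 (x, w.1)
    have h3 := hDB (x, w.1)
    rw [abs_le]
    constructor <;> simp only [φ] <;> linarith
  obtain ⟨hintφ, heqφ⟩ := hm.integral_integral_Psi (lastObs k h) (g' k h) μ (β ^ k) hφ hφB
  have hstep : ∀ ys : Y × ℝ,
      ∫ p : X × Y, φ p.1 (p.2, ys.2 + β ^ k * c (lastObs k h) ys.1 (g' k h))
          * q p.1 p.2 (lastObs k h) ys.1 (g' k h) ∂(lam.prod ν)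
        ≤ condValue lam ν q c U β g (n + 1) k h' ys.1 ys.2 + (C + 2) * η := fun ys => by
    have hI1 := hm.integrable_mul_density (lastObs k h) ys.1 (g' k h)
      (φ := fun p => condValue lam ν q c U β g n (k + 1) (h', g k h', p.1) p.2
        (ys.2 + β ^ k * c (lastObs k h) ys.1 (g' k h)))
      (hcv.comp (f := fun p : X × Y =>
        (p.1, p.2, ys.2 + β ^ k * c (lastObs k h) ys.1 (g' k h))) (by fun_prop))
      (fun p => hm.abs_condValue_le hB g n (k + 1) _ _ _)
    have hDi : Integrable D (lam.prod ν) := Integrable.of_bound hD.aestronglyMeasurable (2 * B)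
      (Filter.Eventually.of_forall fun p => by rw [Real.norm_of_nonneg (hD0 p)]; exact hDB p)
    have hI2 := hDi.mul_const C
    have hI3 := (hm.integrable_density (lastObs k h) ys.1 (g' k h)).const_mul (2 * η)
    have hI23 : Integrable (fun p : X × Y =>
        D p * C + 2 * η * q p.1 p.2 (lastObs k h) ys.1 (g' k h)) (lam.prod ν) := hI2.add hI3
    have hval : condValue lam ν q c U β g (n + 1) k h' ys.1 ys.2
        = ∫ p : X × Y, condValue lam ν q c U β g n (k + 1) (h', g k h', p.1) p.2
            (ys.2 + β ^ k * c (lastObs k h) ys.1 (g' k h))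
          * q p.1 p.2 (lastObs k h) ys.1 (g' k h) ∂(lam.prod ν) := by
      rw [hobs, hact]
      rfl
    calc _ ≤ ∫ p : X × Y, (condValue lam ν q c U β g n (k + 1) (h', g k h', p.1) p.2
            (ys.2 + β ^ k * c (lastObs k h) ys.1 (g' k h))
          * q p.1 p.2 (lastObs k h) ys.1 (g' k h)
          + (D p * C + 2 * η * q p.1 p.2 (lastObs k h) ys.1 (g' k h))) ∂(lam.prod ν) := by
          refine integral_mono (hm.integrable_mul_density _ _ _
            (hφ.comp (f := fun p : X × Y =>
              (p.1, p.2, ys.2 + β ^ k * c (lastObs k h) ys.1 (g' k h))) (by fun_prop))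
            (fun p => hφB _ _)) (hI1.add hI23) fun p => ?_
          have := mul_le_mul_of_nonneg_left
            (hm.density_le p.1 p.2 (lastObs k h) ys.1 (g' k h)) (hD0 p)
          simp only [φ, add_mul]
          linarith
      _ = condValue lam ν q c U β g (n + 1) k h' ys.1 ys.2
          + ((∫ p, D p ∂(lam.prod ν)) * C + 2 * η) := by
          refine (integral_add hI1 hI23).trans ?_
          rw [integral_add hI2 hI3, integral_mul_const, integral_const_mul, hm.integral_density,
            mul_one, hval]
      _ ≤ _ := by nlinarith [mul_le_mul_of_nonneg_right hDη hC]
  have hL : Integrable (fun ys : Y × ℝ =>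
      ∫ p : X × Y, φ p.1 (p.2, ys.2 + β ^ k * c (lastObs k h) ys.1 (g' k h))
          * q p.1 p.2 (lastObs k h) ys.1 (g' k h) ∂(lam.prod ν)) μ := by
    refine Integrable.of_bound (StronglyMeasurable.integral_prod_right' (ν := lam.prod ν)
      (f := fun t : (Y × ℝ) × (X × Y) =>
        φ t.2.1 (t.2.2, t.1.2 + β ^ k * c (lastObs k h) t.1.1 (g' k h))
          * q t.2.1 t.2.2 (lastObs k h) t.1.1 (g' k h)) ?_).aestronglyMeasurable
      (3 * B + 2 * η) (Filter.Eventually.of_forall fun ys =>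
        hm.abs_integral_mul_density_le _ _ _ fun p => hφB _ _)
    have hcost := hm.measurable_cost_comp (T := (Y × ℝ) × (X × Y)) (x := fun _ => lastObs k h)
      (y := fun t => t.1.1) (a := fun _ => g' k h) (by fun_prop) (by fun_prop) (by fun_prop)
    exact ((hφ.comp (f := fun t : (Y × ℝ) × (X × Y) =>
      (t.2.1, t.2.2, t.1.2 + β ^ k * c (lastObs k h) t.1.1 (g' k h)))
        ((measurable_fst.comp measurable_snd).prodMk ((measurable_snd.comp measurable_snd).prodMk
          ((measurable_snd.comp measurable_fst).add (hcost.const_mul _))))).mul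
      (hm.measurable_density_comp (by fun_prop) (by fun_prop) (by fun_prop) (by fun_prop)
        (by fun_prop))).stronglyMeasurable
  have hR : Integrable (fun ys : Y × ℝ => condValue lam ν q c U β g (n + 1) k h' ys.1 ys.2) μ :=
    Integrable.of_bound (hm.measurable_condValue_comp hU hg (n + 1) k measurable_const
      measurable_fst measurable_snd).aestronglyMeasurable B
      (Filter.Eventually.of_forall fun ys => hm.abs_condValue_le hB g (n + 1) k _ _ _)
  have hCη : 0 ≤ (C + 2) * η := by positivity
  calc _ = _ := heq'.symm
    _ ≤ ∫ x', ((∫ w, φ x' w ∂(Psi q c ν (lastObs k h) (g' k h) x' μ (β ^ k))) + err) ∂lam :=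
        integral_mono hint' (hintφ.add (integrable_const err)) hnext
    _ = (∫ x', ∫ w, φ x' w ∂(Psi q c ν (lastObs k h) (g' k h) x' μ (β ^ k)) ∂lam) + err := by
        rw [integral_add hintφ (integrable_const err)]
        simp
    _ ≤ (∫ ys, (condValue lam ν q c U β g (n + 1) k h' ys.1 ys.2 + (C + 2) * η) ∂μ) + err := by
        rw [heqφ]
        exact add_le_add (integral_mono hL (hR.add (integrable_const _)) hstep) le_rfl
    _ = (∫ ys, condValue lam ν q c U β g (n + 1) k h' ys.1 ys.2 ∂μ)
          + μ.real Set.univ * ((C + 2) * η) + err := by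
        rw [integral_add hR (integrable_const _), integral_const, smul_eq_mul]
    _ ≤ _ := by gcongr

theorem exists_markov_rule (hm : IsModel lam ν q c C cb) (hU : Measurable U)
    (hB : ∀ s, |U s| ≤ B) (hg : ∀ k, Measurable (g k)) (n k : ℕ) (e : ℕ → Hist X A k × A)
    {M : ℝ≥0∞} (hM : M < ∞) {δ : ℝ} (hδ : 0 < δ) :
    ∃ f : IS X Y → A, Measurable f ∧ ∀ s : IS X Y, ∃ i,
      f s = g (k + 1) ((e i).1, (e i).2, s.1) ∧ (s.2.1 Set.univ ≤ M → ∀ j,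
        ∫ w, condValue lam ν q c U β g n (k + 1) ((e i).1, (e i).2, s.1) w.1 w.2 ∂s.2.1
          ≤ ∫ w, condValue lam ν q c U β g n (k + 1) ((e j).1, (e j).2, s.1) w.1 w.2 ∂s.2.1
            + δ) := by
  classical
  have hset : MeasurableSet {s : IS X Y | s.2.1 Set.univ ≤ M} :=
    measurableSet_le ((Measure.measurable_coe MeasurableSet.univ).comp
      (measurable_fst.comp measurable_snd)) measurable_const
  let κ : Kernel (IS X Y) (Y × ℝ) :=
    ⟨fun s => if s.2.1 Set.univ ≤ M then s.2.1 else 0,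
      Measurable.ite hset (measurable_fst.comp measurable_snd) measurable_const⟩
  have hκM : ∀ s, κ s Set.univ ≤ M := fun s => by
    change (if s.2.1 Set.univ ≤ M then s.2.1 else 0) Set.univ ≤ M
    split_ifs with h
    · exact h
    · simp
  have : IsFiniteKernel κ := ⟨M, hM, hκM⟩
  let W : ℕ → IS X Y → ℝ := fun i s =>
    ∫ w, condValue lam ν q c U β g n (k + 1) ((e i).1, (e i).2, s.1) w.1 w.2 ∂κ s
  have hW : ∀ i, Measurable (W i) := fun i =>
    (StronglyMeasurable.integral_kernel_prod_right' (κ := κ)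
      (f := fun t : IS X Y × (Y × ℝ) =>
        condValue lam ν q c U β g n (k + 1) ((e i).1, (e i).2, t.1.1) t.2.1 t.2.2)
      (hm.measurable_condValue_comp hU hg n (k + 1)
        (measurable_histSnoc measurable_const measurable_const (by fun_prop)) (by fun_prop)
        (by fun_prop)).stronglyMeasurable).measurable
  have hB0 : 0 ≤ B := (abs_nonneg _).trans (hB 0)
  have hb : ∀ i s, -(B * M.toReal) ≤ W i s := fun i s => by
    have h1 := norm_integral_le_of_norm_le_const (μ := κ s) (C := B)
      (f := fun w => condValue lam ν q c U β g n (k + 1) ((e i).1, (e i).2, s.1) w.1 w.2)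
      (Filter.Eventually.of_forall fun w => hm.abs_condValue_le hB g n (k + 1) _ _ _)
    have h2 : (κ s).real Set.univ ≤ M.toReal := ENNReal.toReal_mono hM.ne (hκM s)
    exact (abs_le.1 (h1.trans (mul_le_mul_of_nonneg_left h2 hB0))).1
  obtain ⟨ι, hι, hmin⟩ := exists_measurable_argmin_approx hW hb hδ
  refine ⟨fun s => g (k + 1) ((e (ι s)).1, (e (ι s)).2, s.1), ?_, fun s =>
    ⟨ι s, rfl, fun hs j => ?_⟩⟩
  · have he : Measurable e := measurable_from_top
    refine (hg (k + 1)).comp (measurable_histSnoc ?_ ?_ measurable_fst)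
    · exact measurable_fst.comp (he.comp hι)
    · exact measurable_snd.comp (he.comp hι)
  · have hκs : κ s = s.2.1 := if_pos hs
    have := hmin s j
    simp only [W, hκs] at this
    exact this

theorem exists_markov_le (hm : IsModel lam ν q c C cb) (hU : Measurable U)
    (hB : ∀ s, |U s| ≤ B) (hβ0 : 0 ≤ β) (hβ1 : β ≤ 1) (hC : 1 ≤ C) (hcb : 0 ≤ cb)
    (Q0Y : Measure Y) [IsProbabilityMeasure Q0Y] {D : X → Set A} (hg : ∀ k, Measurable (g k))
    (hgD : ∀ k h, g k h ∈ D (lastObs k h)) {N : ℕ}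
    (hT : ∀ η > 0, ∃ T : Finset ℝ, ∀ s, ∃ t ∈ T, ∀ a, 0 ≤ a → a ≤ N * cb →
      |U (s + a) - U (t + a)| ≤ η) (x : X) {ε : ℝ} (hε : 0 < ε) :
    ∃ f : ℕ → IS X Y → A, (∀ k, Measurable (f k)) ∧ (∀ k s, f k s ∈ D s.1) ∧
      Vnpi lam ν q c U β f N (x, Q0Y.prod (Measure.dirac (0 : ℝ)), 1)
        ≤ Jpol lam ν Q0Y q c U β g N x + ε := by
  set K : ℝ := C ^ N * (C + 2) + 1 with hK
  have hK0 : 0 < K := by positivity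
  set η : ℝ := ε / ((N + 1) * K) with hη
  have hη0 : 0 < η := by positivity
  have hbud : N * (K * η) ≤ ε := by
    have : (N + 1) * (K * η) = ε := by rw [hη]; field_simp
    nlinarith [mul_pos hK0 hη0]
  obtain ⟨T, hT⟩ := hT η hη0
  have hTn : ∀ n ≤ N, ∀ s, ∃ t ∈ T, ∀ a, 0 ≤ a → a ≤ n * cb → |U (s + a) - U (t + a)| ≤ η :=
    fun n hn s => by
      obtain ⟨t, htT, ht⟩ := hT s
      refine ⟨t, htT, fun a ha0 ha => ht a ha0 (ha.trans ?_)⟩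
      gcongr
  have hne : ∀ k, Nonempty (Hist X A k × A) := fun k => by
    have : ∀ k, Nonempty (Hist X A k) := fun k => by
      induction k with
      | zero => exact ⟨x⟩
      | succ k ih => exact ih.elim fun h => ⟨(h, g k h, x)⟩
    exact ⟨(this k).some, g k (this k).some⟩
  choose e he using fun k => hm.exists_seq_prefix hU hB hβ0 hβ1 hg (N - (k + 1)) k hη0
    (hTn _ (Nat.sub_le _ _))
  have hMtop : ENNReal.ofReal C ^ N < ∞ := ENNReal.pow_lt_top ENNReal.ofReal_lt_top
  choose f hf hfe using fun k =>
    hm.exists_markov_rule (β := β) hU hB hg (N - (k + 1)) k (e k) hMtop hη0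
  let F : ℕ → IS X Y → A := fun k => Nat.casesOn k (fun s => g 0 s.1) f
  have hF : ∀ k, Measurable (F k) := fun k => by
    cases k with
    | zero => exact (hg 0).comp measurable_fst
    | succ k => exact hf k
  have hFD : ∀ k s, F k s ∈ D s.1 := fun k s => by
    cases k with
    | zero => exact hgD 0 s.1
    | succ k =>
      obtain ⟨i, hi, -⟩ := hfe k s
      change f k s ∈ D s.1
      rw [hi]
      exact hgD (k + 1) ((e k i).1, (e k i).2, s.1)
  refine ⟨F, hF, hFD, ?_⟩
  have hg' := hm.measurable_inducedPolicy Q0Y β hF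
  rw [← hm.Jpol_inducedPolicy hU hB Q0Y β hg', hm.Jpol_eq_integral_condValue hU hB hg,
    hm.Jpol_eq_integral_condValue hU hB hg']
  set g' := inducedPolicy ν Q0Y q c β F with hg'def
  have hmass : ∀ k ≤ N, ∀ h : Hist X A k,
      infoState ν Q0Y q c β k h Set.univ ≤ ENNReal.ofReal C ^ N := fun k hk h =>
    ((hm.measurable_infoState_and_univ_le Q0Y β k).2 h).trans
      (pow_le_pow_right₀ (ENNReal.one_le_ofReal.2 hC) hk)
  have hmassr : ∀ k ≤ N, ∀ h : Hist X A k,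
      (infoState ν Q0Y q c β k h).real Set.univ ≤ C ^ N := fun k hk h => by
    have := ENNReal.toReal_mono hMtop.ne (hmass k hk h)
    rwa [ENNReal.toReal_pow, ENNReal.toReal_ofReal (by linarith)] at this
  have step : ∀ (n k : ℕ) (h h' : Hist X A k) (err : ℝ), k + 1 + n = N →
      lastObs k h = lastObs k h' → g' k h = g k h' →
      (∀ (h : Hist X A (k + 1)) (i : ℕ),
        ∫ w, condValue lam ν q c U β g' n (k + 1) h w.1 w.2 ∂(infoState ν Q0Y q c β (k + 1) h)
          ≤ ∫ w, condValue lam ν q c U β g n (k + 1) ((e k i).1, (e k i).2, lastObs (k + 1) h)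
              w.1 w.2 ∂(infoState ν Q0Y q c β (k + 1) h) + err) →
      ∫ w, condValue lam ν q c U β g' (n + 1) k h w.1 w.2 ∂(infoState ν Q0Y q c β k h)
        ≤ ∫ w, condValue lam ν q c U β g (n + 1) k h' w.1 w.2 ∂(infoState ν Q0Y q c β k h)
          + C ^ N * ((C + 2) * η) + err := by
    intro n k h h' err hn hobs hact hnext
    obtain ⟨j, E, hE, hE0, hEB, hEη, hgap⟩ := he k h' (g k h')
    rw [show N - (k + 1) = n by omega] at hgap
    refine hm.integral_condValue_succ_le hU hB hg hg' Q0Y n k h h' hobs hact (by linarith)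
      (hmassr k (by omega) h) hη0.le hE hE0 hEB hEη fun x' => ?_
    refine (hnext (h, g' k h, x') j).trans ?_
    have := hm.isFiniteMeasure_infoState Q0Y β (k + 1) (h, g' k h, x')
    have hcv : ∀ p : Hist X A (k + 1), Integrable (fun w : Y × ℝ =>
        condValue lam ν q c U β g n (k + 1) p w.1 w.2)
          (infoState ν Q0Y q c β (k + 1) (h, g' k h, x')) := fun p =>
      Integrable.of_bound (hm.measurable_condValue_comp hU hg n (k + 1) measurable_const
        measurable_fst measurable_snd).aestronglyMeasurable B
        (Filter.Eventually.of_forall fun w => hm.abs_condValue_le hB g n (k + 1) _ _ _)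
    have hEi : Integrable (fun w : Y × ℝ => E (x', w.1) + 2 * η)
        (infoState ν Q0Y q c β (k + 1) (h, g' k h, x')) :=
      (Integrable.of_bound (hE.comp (f := fun w : Y × ℝ => (x', w.1))
        (by fun_prop)).aestronglyMeasurable (2 * B) (Filter.Eventually.of_forall fun w => by
          rw [Function.comp_apply, Real.norm_of_nonneg (hE0 _)]; exact hEB _)).add
        (integrable_const _)
    exact add_le_add (integral_mono (hcv _) ((hcv _).add hEi)
      fun w => hgap x' w.1 w.2) le_rfl
  have claim : ∀ (n k : ℕ), k + 1 + n = N → ∀ (h : Hist X A (k + 1)) (i : ℕ),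
      ∫ w, condValue lam ν q c U β g' n (k + 1) h w.1 w.2 ∂(infoState ν Q0Y q c β (k + 1) h)
        ≤ ∫ w, condValue lam ν q c U β g n (k + 1) ((e k i).1, (e k i).2, lastObs (k + 1) h)
            w.1 w.2 ∂(infoState ν Q0Y q c β (k + 1) h) + n * (K * η) := by
    intro n
    induction n with
    | zero => intro k _ h i; simp [condValue]
    | succ n ih =>
      intro k hn h i
      obtain ⟨i₀, hi₀, hopt⟩ :=
        hfe k (lastObs (k + 1) h, infoState ν Q0Y q c β (k + 1) h, β ^ (k + 1))
      rw [show N - (k + 1) = n + 1 by omega] at hopt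
      have h1 := step n (k + 1) h ((e k i₀).1, (e k i₀).2, lastObs (k + 1) h) _ (by omega) rfl
        hi₀ (ih (k + 1) (by omega))
      have h2 := hopt (hmass (k + 1) (by omega) h) i
      push_cast
      simp only at h2
      rw [hK] at h1 ⊢
      linarith
  cases N with
  | zero => simp only [condValue]; linarith
  | succ N =>
    have h1 := step N 0 x x _ (by omega) rfl rfl (claim N 0 (by omega))
    push_cast at hbud
    rw [hK] at h1 hbud
    refine h1.trans ?_
    rw [add_assoc]
    refine add_le_add le_rfl ?_
    linarith

end IsModel

theorem exists_finset_forall_abs_sub_le {U : ℝ → ℝ} (hU : Continuous U) {S : ℝ} (hS : 0 ≤ S)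
    {η : ℝ} (hη : 0 < η) :
    ∃ T : Finset ℝ, ∀ s, ∃ t ∈ T, ∀ a, 0 ≤ a → a ≤ S →
      |U (max 0 (min (s + a) S)) - U (max 0 (min (t + a) S))| ≤ η := by
  have hV : Continuous fun s => U (max 0 (min s S)) := by fun_prop
  obtain ⟨δ, hδ, hUC⟩ := Metric.uniformContinuousOn_iff.1
    (isCompact_Icc.uniformContinuousOn_of_continuous (s := Set.Icc (-S) (2 * S)) hV.continuousOn)
    η hη
  obtain ⟨T, hTS, hTf, hcov⟩ := (isCompact_Icc (a := -S) (b := S)).finite_cover_balls hδ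
  refine ⟨hTf.toFinset, fun s => ?_⟩
  have hs' : max (-S) (min s S) ∈ Set.Icc (-S) S :=
    ⟨le_max_left _ _, max_le (by linarith) (min_le_right _ _)⟩
  obtain ⟨t, htT, ht⟩ := Set.mem_iUnion₂.1 (hcov hs')
  refine ⟨t, hTf.mem_toFinset.2 htT, fun a ha0 ha => ?_⟩
  have ht' := hTS htT
  have hclamp : max 0 (min (s + a) S) = max 0 (min (max (-S) (min s S) + a) S) := by
    rcases le_total s (-S) with h | h
    · rw [min_eq_left (by linarith : s ≤ S), max_eq_left h, max_eq_left, max_eq_left]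
      · exact (min_le_left _ _).trans (by linarith)
      · exact (min_le_left _ _).trans (by linarith)
    · rcases le_total s S with h' | h'
      · rw [min_eq_left h', max_eq_right h]
      · rw [min_eq_right h', max_eq_right (by linarith : -S ≤ S),
          min_eq_right (by linarith : S ≤ s + a), min_eq_right (by linarith : S ≤ S + a)]
  rw [hclamp]
  refine (hUC _ ⟨by linarith [hs'.1], by linarith [hs'.2]⟩ _
    ⟨by linarith [ht'.1], by linarith [ht'.2]⟩ ?_).le
  rw [dist_add_right]
  exact ht

theorem Scost_mem_Icc {X Y A : Type u} {c : X → Y → A → ℝ} (hc : ∀ x y a, 0 ≤ c x y a) {cb : ℝ}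
    (hcb : ∀ x y a, c x y a ≤ cb) {β : ℝ} (hβ0 : 0 ≤ β) (hβ1 : β ≤ 1)
    (g : ∀ k, Hist X A k → A) (n : ℕ) (p : Path X Y n) :
    Scost c β g n p ∈ Set.Icc 0 (n * cb) := by
  induction n with
  | zero => simp [Scost]
  | succ n ih =>
    obtain ⟨h1, h2⟩ := ih p.1
    have h3 := hc (lastX n p.1) (lastY n p.1) (g n (obsHist g n p.1))
    have h4 := (mul_le_of_le_one_left h3 (pow_le_one₀ hβ0 hβ1 (n := n))).trans (hcb _ _ _)
    refine ⟨add_nonneg h1 (by positivity), ?_⟩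
    simp only [Scost]
    push_cast
    linarith

theorem Efun_congr {X Y A : Type u} [MeasurableSpace X] [MeasurableSpace Y] {lam : Measure X}
    {ν : Measure Y} {q : X → Y → X → Y → A → ℝ} {c : X → Y → A → ℝ} {cb : ℝ}
    (hc : ∀ x y a, 0 ≤ c x y a) (hcb : ∀ x y a, c x y a ≤ cb) (hcb0 : 0 ≤ cb) {U V : ℝ → ℝ}
    {S : ℝ} (hUV : ∀ s, 0 ≤ s → s ≤ S → U s = V s) {β : ℝ} (hβ0 : 0 ≤ β) (hβ1 : β ≤ 1) (n : ℕ)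
    (f : ℕ → IS X Y → A) (x : X) (y : Y) (μ : Measure (Y × ℝ)) {z s : ℝ} (hz : 0 ≤ z)
    (hs : 0 ≤ s) (hsS : s + z * (n * cb) ≤ S) :
    Efun lam ν q c U β n f x y μ z s = Efun lam ν q c V β n f x y μ z s := by
  induction n generalizing f x y μ z s with
  | zero => exact hUV s hs (by simpa using hsS)
  | succ n ih =>
    simp only [Efun]
    refine integral_congr_ae (Filter.Eventually.of_forall fun p => ?_)
    refine congrArg (· * q p.1 p.2 x y (f 0 (x, μ, z))) (ih _ _ _ _ (by positivity) ?_ ?_)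
    · have := hc x y (f 0 (x, μ, z))
      positivity
    · have h1 := mul_le_mul_of_nonneg_left (hcb x y (f 0 (x, μ, z))) hz
      have h2 : β * (z * (n * cb)) ≤ z * (n * cb) := mul_le_of_le_one_left (by positivity) hβ1
      push_cast at hsS
      linarith

theorem Vnpi_congr {X Y A : Type u} [MeasurableSpace X] [MeasurableSpace Y] {lam : Measure X}
    {ν : Measure Y} {q : X → Y → X → Y → A → ℝ} {c : X → Y → A → ℝ} {cb : ℝ}
    (hc : ∀ x y a, 0 ≤ c x y a) (hcb : ∀ x y a, c x y a ≤ cb) (hcb0 : 0 ≤ cb) {U V : ℝ → ℝ}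
    {n : ℕ} (hUV : ∀ s, 0 ≤ s → s ≤ n * cb → U s = V s) {β : ℝ} (hβ0 : 0 ≤ β) (hβ1 : β ≤ 1)
    (f : ℕ → IS X Y → A) (x : X) (Q0Y : Measure Y) [SFinite Q0Y] :
    Vnpi lam ν q c U β f n (x, Q0Y.prod (Measure.dirac (0 : ℝ)), 1)
      = Vnpi lam ν q c V β f n (x, Q0Y.prod (Measure.dirac (0 : ℝ)), 1) := by
  have hae : ∀ᵐ ys : Y × ℝ ∂(Q0Y.prod (Measure.dirac (0 : ℝ))), ys.2 = 0 :=
    Measure.quasiMeasurePreserving_snd.ae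
      ((ae_dirac_iff (p := fun s : ℝ => s = 0) (measurableSet_singleton 0)).2 rfl)
  refine integral_congr_ae (hae.mono fun ys hys => ?_)
  exact Efun_congr hc hcb hcb0 hUV hβ0 hβ1 n f x ys.1 _ zero_le_one hys.ge (by simp [hys])

/-- value representation: the optimal value of the partially observed
risk-sensitive control problem coincides with the value function of the information-state
MDP evaluated at the initial information state: `V_N(x, Q_0^Y ⊗ δ_0, 1) = J_N(x)` for every
`x ∈ X`, where `J_N(x) = inf_π J_{Nπ}(x)` over all history-dependent POMDP policies. -/
theorem value_representation
    {X Y A : Type u}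
    [MeasurableSpace X] [TopologicalSpace X]
    [MeasurableSpace Y] [TopologicalSpace Y]
    [MeasurableSpace A] [TopologicalSpace A] [AddCommGroup A] [Module ℝ A]
    (lam : Measure X) (ν : Measure Y) [IsProbabilityMeasure lam] [IsProbabilityMeasure ν]
    (Q0Y : Measure Y) [IsProbabilityMeasure Q0Y]
    (q : X → Y → X → Y → A → ℝ)
    (hq_cont : Continuous fun p : X × Y × X × Y × A => q p.1 p.2.1 p.2.2.1 p.2.2.2.1 p.2.2.2.2)
    (hq_meas : Measurable fun p : X × Y × X × Y × A => q p.1 p.2.1 p.2.2.1 p.2.2.2.1 p.2.2.2.2)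
    (hq_nonneg : ∀ x' y' x y a, 0 ≤ q x' y' x y a)
    (hq_bdd : ∃ C : ℝ, ∀ x' y' x y a, q x' y' x y a ≤ C)
    (hq_dens : ∀ x y a, ∫⁻ p : X × Y, ENNReal.ofReal (q p.1 p.2 x y a) ∂(lam.prod ν) = 1)
    (c : X → Y → A → ℝ)
    (hc_cont : Continuous fun p : X × Y × A => c p.1 p.2.1 p.2.2)
    (hc_meas : Measurable fun p : X × Y × A => c p.1 p.2.1 p.2.2)
    (hc_nonneg : ∀ x y a, 0 ≤ c x y a)
    (hc_bdd : ∃ cb : ℝ, ∀ x y a, c x y a ≤ cb)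
    (U : ℝ → ℝ) (hU_cont : Continuous U) (hU_mono : StrictMono U)
    (β : ℝ) (hβ0 : 0 < β) (hβ1 : β < 1)
    (D : X → Set A) (hD_ne : ∀ x, (D x).Nonempty) (hD_conv : ∀ x, Convex ℝ (D x))
    (hD_cpt : ∀ x, IsCompact (D x))
    (N : ℕ)
 :
    ∀ x : X,
      Vopt lam ν q c U β D N (x, Q0Y.prod (Measure.dirac (0 : ℝ)), 1)
        = ⨅ g : {g : ∀ k, Hist X A k → A //
              (∀ k, Measurable (g k)) ∧ ∀ k (h : Hist X A k), g k h ∈ D (lastObs k h)},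
            Jpol lam ν Q0Y q c U β g.1 N x := by
  obtain ⟨C, hC⟩ := hq_bdd
  obtain ⟨cb, hcb⟩ := hc_bdd
  intro x
  have hcb' : ∀ x y a, c x y a ≤ max cb 0 := fun x y a => (hcb x y a).trans (le_max_left _ _)
  have hcb0 : 0 ≤ max cb 0 := le_max_right _ _
  have hm : IsModel lam ν q c C (max cb 0) :=
    ⟨hq_meas, hq_nonneg, hC, hq_dens, hc_meas, hc_nonneg, hcb'⟩
  have hS : 0 ≤ N * max cb 0 := by positivity
  set V : ℝ → ℝ := fun s => U (max 0 (min s (N * max cb 0))) with hVdef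
  have hV : Measurable V := (hU_cont.comp (by fun_prop)).measurable
  obtain ⟨B, hB⟩ := (isCompact_Icc (a := 0) (b := N * max cb 0)).exists_bound_of_continuousOn
    hU_cont.continuousOn
  have hVB : ∀ s, |V s| ≤ B := fun s => hB _ ⟨le_max_left _ _, max_le hS (min_le_right _ _)⟩
  have hUV : ∀ s, 0 ≤ s → s ≤ N * max cb 0 → U s = V s := fun s h0 h1 => by
    simp only [hVdef, min_eq_left h1, max_eq_right h0]
  have hJ : ∀ g : ∀ k, Hist X A k → A,
      Jpol lam ν Q0Y q c U β g N x = Jpol lam ν Q0Y q c V β g N x := fun g =>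
    integral_congr_ae (Filter.Eventually.of_forall fun p =>
      have hp := Scost_mem_Icc hc_nonneg hcb' hβ0.le hβ1.le g N p
      hUV _ hp.1 hp.2)
  have hVn : ∀ f : ℕ → IS X Y → A,
      Vnpi lam ν q c U β f N (x, Q0Y.prod (Measure.dirac (0 : ℝ)), 1)
        = Vnpi lam ν q c V β f N (x, Q0Y.prod (Measure.dirac (0 : ℝ)), 1) := fun f =>
    Vnpi_congr hc_nonneg hcb' hcb0 hUV hβ0.le hβ1.le f x Q0Y
  have hind : ∀ f : ℕ → IS X Y → A, (∀ k, Measurable (f k)) →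
      Jpol lam ν Q0Y q c U β (inducedPolicy ν Q0Y q c β f) N x
        = Vnpi lam ν q c U β f N (x, Q0Y.prod (Measure.dirac (0 : ℝ)), 1) := fun f hf => by
    rw [hJ, hVn]
    exact hm.Jpol_inducedPolicy hV hVB Q0Y β (hm.measurable_inducedPolicy Q0Y β hf) N x
  have hJB : ∀ g : ∀ k, Hist X A k → A, (∀ k, Measurable (g k)) →
      -B ≤ Jpol lam ν Q0Y q c U β g N x := fun g hg => by
    rw [hJ, hm.Jpol_eq_integral_condValue hV hVB hg]
    have h := norm_integral_le_of_norm_le_const (μ := Q0Y.prod (Measure.dirac (0 : ℝ))) (C := B)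
      (f := fun ys : Y × ℝ => condValue lam ν q c V β g N 0 x ys.1 ys.2)
      (Filter.Eventually.of_forall fun ys => hm.abs_condValue_le hVB g N 0 _ _ _)
    rw [probReal_univ, mul_one] at h
    exact (abs_le.1 h).1
  let G := {g : ∀ k, Hist X A k → A //
    (∀ k, Measurable (g k)) ∧ ∀ k (h : Hist X A k), g k h ∈ D (lastObs k h)}
  let F := {f : ℕ → IS X Y → A // (∀ k, Measurable (f k)) ∧ ∀ k (s : IS X Y), f k s ∈ D s.1}
  let ind : F → G := fun f => ⟨inducedPolicy ν Q0Y q c β f.1,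
    hm.measurable_inducedPolicy Q0Y β f.2.1, fun k h =>
      f.2.2 k (lastObs k h, infoState ν Q0Y q c β k h, β ^ k)⟩
  have hG : BddBelow (Set.range fun g : G => Jpol lam ν Q0Y q c U β g.1 N x) :=
    ⟨-B, by rintro _ ⟨g, rfl⟩; exact hJB g.1 g.2.1⟩
  have hF : BddBelow (Set.range fun f : F =>
      Vnpi lam ν q c U β f.1 N (x, Q0Y.prod (Measure.dirac (0 : ℝ)), 1)) :=
    ⟨-B, by rintro _ ⟨f, rfl⟩; exact (hJB _ (ind f).2.1).trans_eq (hind f.1 f.2.1)⟩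
  have happrox : ∀ (g : G) (ε : ℝ), 0 < ε → ∃ f : F,
      Vnpi lam ν q c U β f.1 N (x, Q0Y.prod (Measure.dirac (0 : ℝ)), 1)
        ≤ Jpol lam ν Q0Y q c U β g.1 N x + ε := fun g ε hε => by
    obtain ⟨y⟩ := Q0Y.nonempty_of_neZero
    obtain ⟨f, hf, hfD, hle⟩ := hm.exists_markov_le hV hVB hβ0.le hβ1.le
      (hm.one_le_densityBound x y (g.1 0 x)) hcb0 Q0Y g.2.1 g.2.2
      (fun η hη => exists_finset_forall_abs_sub_le hU_cont hS hη) x hε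
    exact ⟨⟨f, hf, hfD⟩, by rwa [hJ, hVn]⟩
  change (⨅ f : F, Vnpi lam ν q c U β f.1 N (x, Q0Y.prod (Measure.dirac (0 : ℝ)), 1))
    = ⨅ g : G, Jpol lam ν Q0Y q c U β g.1 N x
  rcases isEmpty_or_nonempty G with hGe | hGn
  · have : IsEmpty F := ⟨fun f => hGe.elim (ind f)⟩
    rw [Real.iInf_of_isEmpty, Real.iInf_of_isEmpty]
  · have : Nonempty F := ⟨(happrox hGn.some 1 one_pos).choose⟩
    refine le_antisymm (le_ciInf fun g => le_of_forall_pos_le_add fun ε hε => ?_)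
      (le_ciInf fun f => (ciInf_le hG (ind f)).trans_eq (hind f.1 f.2.1))
    obtain ⟨f, hf⟩ := happrox g ε hε
    exact (ciInf_le hF f).trans hf

end DIMG
end
end

section
/- Joint+marginal lemma (Lemma 1): suppose that for every y ∈ Y the parametric solution set P*_y ⊆ P(X) is nonempty and compact (in the topology of weak convergence). Then the joint optimization problem defining R has an optimal solution, and its value satisfies R = ∫_Y T(y) m(dy). -/
open MeasureTheory
open scoped ENNReal NNReal

noncomputable section

namespace DIMG

/-- `L¹` distance of the densities of two measures on `X` with respect to the reference
measure `λ` (equal to twice the total variation distance when both are `≪ λ`):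
`∫_X |dη/dλ − dη'/dλ| dλ`. -/
noncomputable def tvX {X : Type*} [MeasurableSpace X] (lam : Measure X)
    (η η' : Measure X) : ℝ :=
  ∫ x, |(η.rnDeriv lam x).toReal - (η'.rnDeriv lam x).toReal| ∂lam

/-- `L¹` distance of the densities of two measures on `X × Y` with respect to the reference
measure `λ⊗ν`: `∫_{X×Y} |dP − dP'|`. -/
noncomputable def tvJ {X Y : Type*} [MeasurableSpace X] [MeasurableSpace Y]
    (lam : Measure X) (ν : Measure Y) (P P' : Measure (X × Y)) : ℝ :=
  ∫ p, |(P.rnDeriv (lam.prod ν) p).toReal - (P'.rnDeriv (lam.prod ν) p).toReal| ∂(lam.prod ν)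

/-- The joint measure `P(dx,dy) = φ(dx|y) m(dy)` on `X × Y` built from a marginal `m` on `Y`
and a family of conditional laws `φ(·|y)` on `X`. -/
noncomputable def mixJoint {X Y : Type*} [MeasurableSpace X] [MeasurableSpace Y]
    (m : Measure Y) (φ : Y → Measure X) : Measure (X × Y) :=
  m.bind fun y => (φ y).map fun x => (x, y)

/-- The parametric ("interim") value
`T(y) := inf over η ∈ P(X), η ≪ λ of [∫_X l(x,y) η(dx) + ∫_X |dη/dλ − dψ(·|y)/dλ| dλ]`. -/
noncomputable def Tval {X Y : Type*} [MeasurableSpace X] [MeasurableSpace Y]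
    (lam : Measure X) (l : X → Y → ℝ) (ψ : Y → Measure X) (y : Y) : ℝ :=
  ⨅ η : {η : Measure X // IsProbabilityMeasure η ∧ η ≪ lam},
    (∫ x, l x y ∂(η : Measure X)) + tvX lam (η : Measure X) (ψ y)

/-- The joint ("ex ante") value
`R := inf over P ∈ P(X×Y), P ≪ λ⊗ν with Y-marginal m of [∫ l dP + ∫|dP − dQ|]`. -/
noncomputable def Rval {X Y : Type*} [MeasurableSpace X] [MeasurableSpace Y]
    (lam : Measure X) (ν : Measure Y) (l : X → Y → ℝ) (m : Measure Y)
    (Q : Measure (X × Y)) : ℝ :=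
  ⨅ P : {P : Measure (X × Y) //
      IsProbabilityMeasure P ∧ P ≪ lam.prod ν ∧ P.map Prod.snd = m},
    (∫ p, l p.1 p.2 ∂(P : Measure (X × Y))) + tvJ lam ν (P : Measure (X × Y)) Q

section Density

variable {Ω : Type*} [MeasurableSpace Ω] {D P Q N : Measure Ω} {L α : Ω → ℝ} {C ε : ℝ}

/-- Excess, at a point, of the cost integrand over the pointwise lower bound, where `p` and `q` are
the values of the two densities, `L` is the loss and `a` is the shadow price of mass. -/
def slack (L a p q : ℝ) : ℝ :=
  p * L + |p - q| - q * min L (a + 2) - (p * (a + 1) - q * (a + 1))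

lemma slack_nonneg {L a p q : ℝ} (hp : 0 ≤ p) (hL : a ≤ L) : 0 ≤ slack L a p q := by
  unfold slack
  rcases min_cases L (a + 2) with ⟨h, h'⟩ | ⟨h, h'⟩ <;> rw [h] <;>
    rcases abs_cases (p - q) with ⟨k, k'⟩ | ⟨k, k'⟩ <;> rw [k] <;> nlinarith

lemma le_of_slack_eq_zero {L a p q : ℝ} (hq : 0 ≤ q) (hL : a < L)
    (h : slack L a p q = 0) : p ≤ q := by
  by_contra! hpq
  unfold slack at h
  rw [abs_of_pos (sub_pos.2 hpq)] at h
  nlinarith [mul_pos (sub_pos.2 hpq) (sub_pos.2 hL),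
    mul_nonneg hq (sub_nonneg.2 (min_le_left L (a + 2)))]

lemma integrable_of_abs_le [IsFiniteMeasure P] {f : Ω → ℝ} (hf : Measurable f)
    (hb : ∀ x, |f x| ≤ C) : Integrable f P :=
  .of_bound hf.aestronglyMeasurable C (ae_of_all _ hb)

lemma abs_min_add_two_le {L a : ℝ} (hL : |L| ≤ C) (ha : |a| ≤ C) : |min L (a + 2)| ≤ C + 2 := by
  rw [abs_le] at *
  constructor
  · apply le_min <;> linarith
  · exact (min_le_left _ _).trans (by linarith)

lemma integrable_slack_and_integral_slack [SigmaFinite D] [IsFiniteMeasure P] [IsFiniteMeasure Q]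
    (hP : P ≪ D) (hQ : Q ≪ D) (hL : Measurable L) (hα : Measurable α)
    (hLC : ∀ x, |L x| ≤ C) (hαC : ∀ x, |α x| ≤ C)
    (hPQ : ∫ x, (α x + 1) ∂P = ∫ x, (α x + 1) ∂Q) :
    Integrable (fun x ↦ slack (L x) (α x) (P.rnDeriv D x).toReal (Q.rnDeriv D x).toReal) D ∧
    ∫ x, slack (L x) (α x) (P.rnDeriv D x).toReal (Q.rnDeriv D x).toReal ∂D =
      (∫ x, L x ∂P) + tvX D P Q - ∫ x, min (L x) (α x + 2) ∂Q := by
  have iα (R : Measure Ω) [IsFiniteMeasure R] : Integrable (fun x ↦ α x + 1) R :=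
    (integrable_of_abs_le hα hαC).add (integrable_const 1)
  have i₁ := (integrable_rnDeriv_smul_iff hP).2 (integrable_of_abs_le (P := P) hL hLC)
  have i₂ := ((Measure.integrable_toReal_rnDeriv (μ := P) (ν := D)).sub
    (Measure.integrable_toReal_rnDeriv (μ := Q))).abs
  have i₃ := (integrable_rnDeriv_smul_iff hQ).2 (integrable_of_abs_le (P := Q)
    (hL.min (hα.add_const 2)) fun x ↦ abs_min_add_two_le (hLC x) (hαC x))
  have i₄ := (integrable_rnDeriv_smul_iff hP).2 (iα P)
  have i₅ := (integrable_rnDeriv_smul_iff hQ).2 (iα Q)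
  refine ⟨((i₁.add i₂).sub i₃).sub (i₄.sub i₅), ?_⟩
  have key := integral_sub ((i₁.add i₂).sub i₃) (i₄.sub i₅)
  rw [integral_sub' (i₁.add i₂) i₃, integral_add' i₁ i₂, integral_sub' i₄ i₅,
    integral_rnDeriv_smul hP, integral_rnDeriv_smul hQ, integral_rnDeriv_smul hP,
    integral_rnDeriv_smul hQ, hPQ, sub_self, sub_zero] at key
  exact key

lemma integral_min_le_cost [SigmaFinite D] [IsFiniteMeasure P] [IsFiniteMeasure Q]
    (hP : P ≪ D) (hQ : Q ≪ D) (hL : Measurable L) (hα : Measurable α)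
    (hLC : ∀ x, |L x| ≤ C) (hαC : ∀ x, |α x| ≤ C) (hαL : ∀ᵐ x ∂D, α x ≤ L x)
    (hPQ : ∫ x, (α x + 1) ∂P = ∫ x, (α x + 1) ∂Q) :
    ∫ x, min (L x) (α x + 2) ∂Q ≤ (∫ x, L x ∂P) + tvX D P Q := by
  have h := (integrable_slack_and_integral_slack hP hQ hL hα hLC hαC hPQ).2
  have h' : 0 ≤ ∫ x, slack (L x) (α x) (P.rnDeriv D x).toReal (Q.rnDeriv D x).toReal ∂D :=
    integral_nonneg_of_ae (hαL.mono fun x hx ↦ slack_nonneg ENNReal.toReal_nonneg hx)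
  linarith

/-- If the optimal value is attained while the loss never equals the shadow price, then no mass
has to be moved. -/
lemma measure_eq_zero_of_cost_eq [SigmaFinite D] [IsProbabilityMeasure P] [IsProbabilityMeasure Q]
    (hP : P ≪ D) (hQ : Q ≪ D) (hL : Measurable L) (hα : Measurable α)
    (hLC : ∀ x, |L x| ≤ C) (hαC : ∀ x, |α x| ≤ C) (hαL : ∀ᵐ x ∂D, α x < L x)
    (hPQ : ∫ x, (α x + 1) ∂P = ∫ x, (α x + 1) ∂Q)
    (heq : (∫ x, L x ∂P) + tvX D P Q = ∫ x, min (L x) (α x + 2) ∂Q) :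
    Q {x | α x + 2 < L x} = 0 := by
  obtain ⟨hi, h⟩ := integrable_slack_and_integral_slack hP hQ hL hα hLC hαC hPQ
  have h0 := (integral_eq_zero_iff_of_nonneg_ae (hαL.mono fun x hx ↦
    slack_nonneg ENNReal.toReal_nonneg hx.le) hi).1 (by rw [h, heq, sub_self])
  have hle : ∀ᵐ x ∂D, (P.rnDeriv D x).toReal ≤ (Q.rnDeriv D x).toReal := by
    filter_upwards [hαL, h0] with x hx h0x
    exact le_of_slack_eq_zero ENNReal.toReal_nonneg hx h0x
  have hpq := (integral_eq_iff_of_ae_le Measure.integrable_toReal_rnDeriv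
    Measure.integrable_toReal_rnDeriv hle).1 (by
      rw [Measure.integral_toReal_rnDeriv hP, Measure.integral_toReal_rnDeriv hQ]; simp)
  have hA : ∀ᵐ x ∂D, α x + 2 < L x → Q.rnDeriv D x = 0 := by
    filter_upwards [h0, hpq, Q.rnDeriv_lt_top D] with x h0x hx htop hlt
    simp only [slack, hx, Pi.zero_apply, sub_self, abs_zero, add_zero, sub_zero,
      min_eq_right hlt.le] at h0x
    rw [← mul_sub] at h0x
    rcases mul_eq_zero.1 h0x with h1 | h1
    · exact ((ENNReal.toReal_eq_zero_iff _).1 h1).resolve_right htop.ne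
    · linarith
  rw [← Measure.withDensity_rnDeriv_eq Q D hQ,
    withDensity_apply _ (measurableSet_lt (hα.add_const 2) hL),
    setLIntegral_congr_fun_ae (measurableSet_lt (hα.add_const 2) hL) hA]
  simp

lemma tvX_add_add_le [SigmaFinite D] [IsFiniteMeasure P] [IsFiniteMeasure Q] [IsFiniteMeasure N]
    (hQ : Q ≪ D) (hN : N ≪ D) :
    tvX D (P + N) (P + Q) ≤ N.real Set.univ + Q.real Set.univ := by
  rw [← Measure.integral_toReal_rnDeriv hN, ← Measure.integral_toReal_rnDeriv hQ,
    ← integral_add Measure.integrable_toReal_rnDeriv Measure.integrable_toReal_rnDeriv]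
  refine integral_mono_of_nonneg (ae_of_all _ fun _ ↦ abs_nonneg _)
    (Measure.integrable_toReal_rnDeriv.add Measure.integrable_toReal_rnDeriv) ?_
  filter_upwards [Measure.rnDeriv_add' P N D, Measure.rnDeriv_add' P Q D, P.rnDeriv_lt_top D,
    Q.rnDeriv_lt_top D, N.rnDeriv_lt_top D] with x h₁ h₂ hp hq hn
  rw [h₁, h₂, Pi.add_apply, Pi.add_apply, ENNReal.toReal_add hp.ne hn.ne,
    ENNReal.toReal_add hp.ne hq.ne, add_sub_add_left_eq_sub]
  exact abs_le.2 ⟨by linarith [@ENNReal.toReal_nonneg (N.rnDeriv D x)],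
    by linarith [@ENNReal.toReal_nonneg (Q.rnDeriv D x)]⟩

/-- Cost of moving the mass of `Q` on `{α + 2 < L}` to `N`, which is carried by `{L ≤ α + ε}`. -/
lemma cost_restrict_add_le [SigmaFinite D] [IsFiniteMeasure Q] [IsFiniteMeasure N]
    (hQ : Q ≪ D) (hN : N ≪ D) (hL : Measurable L) (hα : Measurable α)
    (hLC : ∀ x, |L x| ≤ C) (hαC : ∀ x, |α x| ≤ C) (hNL : ∀ᵐ x ∂N, L x ≤ α x + ε)
    (hNQ : N Set.univ = Q {x | α x + 2 < L x})
    (hint : ∫ x, α x ∂N = ∫ x in {x | α x + 2 < L x}, α x ∂Q) :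
    (∫ x, L x ∂(Q.restrict {x | α x + 2 < L x}ᶜ + N)) +
        tvX D (Q.restrict {x | α x + 2 < L x}ᶜ + N) Q ≤
      (∫ x, min (L x) (α x + 2) ∂Q) + ε * N.real Set.univ := by
  have hA : MeasurableSet {x | α x + 2 < L x} := measurableSet_lt (hα.add_const 2) hL
  have hmin : Measurable fun x ↦ min (L x) (α x + 2) := hL.min (hα.add_const 2)
  have htv := tvX_add_add_le (P := Q.restrict {x | α x + 2 < L x}ᶜ)
    (Measure.restrict_le_self.absolutelyContinuous.trans hQ :
      Q.restrict {x | α x + 2 < L x} ≪ D) hN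
  rw [Measure.restrict_compl_add_restrict hA] at htv
  have hreal : (Q.restrict {x | α x + 2 < L x}).real Set.univ = N.real Set.univ := by
    simp [Measure.real, hNQ]
  have hNle : ∫ x, L x ∂N ≤ (∫ x, α x ∂N) + ε * N.real Set.univ := by
    have h := integral_mono_ae (integrable_of_abs_le hL hLC)
      ((integrable_of_abs_le hα hαC).add (integrable_const ε)) hNL
    have h' := integral_add (integrable_of_abs_le (P := N) hα hαC) (integrable_const ε)
    simp only [integral_const, smul_eq_mul, mul_comm] at h'
    exact h.trans h'.le
  have h₁ : ∫ x in {x | α x + 2 < L x}, min (L x) (α x + 2) ∂Q =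
      (∫ x, α x ∂N) + 2 * N.real Set.univ := by
    rw [setIntegral_congr_fun hA (g := fun x ↦ α x + 2) fun x hx ↦ min_eq_right (le_of_lt hx),
      integral_add (integrable_of_abs_le hα hαC) (integrable_const 2), ← hint, ← hreal]
    simp [mul_comm]
  have h₂ : ∫ x in {x | α x + 2 < L x}ᶜ, min (L x) (α x + 2) ∂Q =
      ∫ x in {x | α x + 2 < L x}ᶜ, L x ∂Q :=
    setIntegral_congr_fun hA.compl fun x hx ↦ min_eq_left (not_lt.1 hx)
  rw [integral_add_measure (integrable_of_abs_le hL hLC) (integrable_of_abs_le hL hLC),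
    ← integral_add_compl hA (integrable_of_abs_le hmin fun x ↦
      abs_min_add_two_le (hLC x) (hαC x)), h₁, h₂]
  linarith

end Density

section EssInf

variable {X Y : Type*} [MeasurableSpace X] [MeasurableSpace Y] {lam : Measure X} {f : X → ℝ}
  {C : ℝ}

lemma isBoundedUnder_ge_of_abs_le (hf : ∀ x, |f x| ≤ C) :
    Filter.IsBoundedUnder (· ≥ ·) (ae lam) f :=
  Filter.isBoundedUnder_of ⟨-C, fun x ↦ (abs_le.1 (hf x)).1⟩

lemma isCoboundedUnder_ge_of_abs_le [NeZero lam] (hf : ∀ x, |f x| ≤ C) :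
    Filter.IsCoboundedUnder (· ≥ ·) (ae lam) f :=
  Filter.IsBoundedUnder.isCoboundedUnder_ge
    (Filter.isBoundedUnder_of ⟨C, fun x ↦ (abs_le.1 (hf x)).2⟩)

lemma essInf_lt_iff_of_abs_le [NeZero lam] (hf : ∀ x, |f x| ≤ C) {c : ℝ} :
    essInf f lam < c ↔ lam {x | f x < c} ≠ 0 := by
  constructor
  · intro h h0
    refine h.not_ge (le_essInf_of_ae_le c ?_ (isCoboundedUnder_ge_of_abs_le hf))
    simpa [Filter.EventuallyLE, ae_iff] using h0
  · intro h
    by_contra! hc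
    exact h (measure_mono_null (fun x hx ↦ lt_of_lt_of_le hx hc)
      (meas_lt_essInf (isBoundedUnder_ge_of_abs_le hf)))

lemma abs_essInf_le [NeZero lam] (hf : ∀ x, |f x| ≤ C) : |essInf f lam| ≤ C := by
  rw [abs_le]
  constructor
  · exact le_essInf_of_ae_le _ (ae_of_all _ fun x ↦ (abs_le.1 (hf x)).1)
      (isCoboundedUnder_ge_of_abs_le hf)
  · obtain ⟨x, hx⟩ := (ae_essInf_le (μ := lam) (isBoundedUnder_ge_of_abs_le hf)).exists
    exact hx.trans (abs_le.1 (hf x)).2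

lemma measurable_essInf [IsProbabilityMeasure lam] {l : X → Y → ℝ}
    (hl : Measurable fun p : X × Y ↦ l p.1 p.2) (hC : ∀ x y, |l x y| ≤ C) :
    Measurable fun y ↦ essInf (l · y) lam := by
  refine measurable_of_Iio fun c ↦ ?_
  have h := measurable_measure_prodMk_right (μ := lam)
    (measurableSet_lt hl (measurable_const (a := c)))
  convert h (measurableSet_singleton 0).compl using 1
  ext y
  exact essInf_lt_iff_of_abs_le (hC · y)

end EssInf

section Parametric

variable {X Y : Type*} [MeasurableSpace X] {lam : Measure X}
  [IsProbabilityMeasure lam] {l : X → Y → ℝ} {ψ : Y → Measure X} {y : Y} {C : ℝ}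

lemma integral_min_essInf_le_cost {η : Measure X} [IsProbabilityMeasure η]
    [IsProbabilityMeasure (ψ y)] (hη : η ≪ lam) (hψ : ψ y ≪ lam) (hl : Measurable (l · y))
    (hC : ∀ x, |l x y| ≤ C) :
    ∫ x, min (l x y) (essInf (l · y) lam + 2) ∂ψ y ≤ (∫ x, l x y ∂η) + tvX lam η (ψ y) :=
  integral_min_le_cost hη hψ hl (measurable_const (a := essInf (l · y) lam)) hC
    (fun _ ↦ abs_essInf_le hC) (ae_essInf_le (isBoundedUnder_ge_of_abs_le hC)) (by simp)

variable [MeasurableSpace Y]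

lemma Tval_eq_integral_min [IsProbabilityMeasure (ψ y)] (hψ : ψ y ≪ lam)
    (hl : Measurable (l · y)) (hC : ∀ x, |l x y| ≤ C) :
    Tval lam l ψ y = ∫ x, min (l x y) (essInf (l · y) lam + 2) ∂ψ y := by
  have hlow (η : {η : Measure X // IsProbabilityMeasure η ∧ η ≪ lam}) :
      ∫ x, min (l x y) (essInf (l · y) lam + 2) ∂ψ y ≤
        (∫ x, l x y ∂(η : Measure X)) + tvX lam (η : Measure X) (ψ y) :=
    have := η.2.1
    integral_min_essInf_le_cost η.2.2 hψ hl hC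
  apply le_antisymm
  · refine le_of_forall_pos_le_add fun ε hε ↦ ?_
    set a := essInf (l · y) lam with ha
    set A := {x | a + 2 < l x y}
    have hA : MeasurableSet A := measurableSet_lt measurable_const hl
    set S := {x | l x y < a + ε}
    have hS : MeasurableSet S := measurableSet_lt hl measurable_const
    have hS0 : lam S ≠ 0 := (essInf_lt_iff_of_abs_le hC).1 (by linarith)
    set N := (ψ y A * (lam S)⁻¹) • lam.restrict S with hN
    have hNuniv : N Set.univ = ψ y A := by
      simp [hN, mul_assoc, ENNReal.inv_mul_cancel hS0 (measure_ne_top lam S)]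
    have : IsFiniteMeasure N := ⟨by rw [hNuniv]; exact measure_lt_top _ _⟩
    have hNac : N ≪ lam :=
      Measure.smul_absolutelyContinuous.trans Measure.restrict_le_self.absolutelyContinuous
    have hcost := cost_restrict_add_le (ε := ε) (α := fun _ ↦ a) hψ hNac hl measurable_const hC
      (fun _ ↦ abs_essInf_le hC)
      (Measure.ae_smul_measure ((ae_restrict_mem hS).mono fun x hx ↦ le_of_lt hx) _)
      hNuniv (by simp [Measure.real, hNuniv, A])
    have hprob : IsProbabilityMeasure ((ψ y).restrict Aᶜ + N) := ⟨by
      rw [Measure.add_apply, hNuniv, Measure.restrict_apply_univ, add_comm,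
        measure_add_measure_compl hA, measure_univ]⟩
    have hac : (ψ y).restrict Aᶜ + N ≪ lam :=
      (Measure.restrict_le_self.absolutelyContinuous.trans hψ).add_left hNac
    refine (ciInf_le ⟨_, Set.forall_mem_range.2 hlow⟩ ⟨_, hprob, hac⟩).trans (hcost.trans ?_)
    have : N.real Set.univ ≤ 1 := by
      rw [Measure.real, hNuniv]; exact measureReal_le_one
    gcongr
    exact mul_le_of_le_one_right hε.le this
  · have : Nonempty {η : Measure X // IsProbabilityMeasure η ∧ η ≪ lam} := ⟨ψ y, ‹_›, hψ⟩
    exact le_ciInf hlow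

/-- If the parametric problem has a solution, then either no mass has to be moved or the essential
infimum of the loss is attained on a set of positive measure. -/
lemma measure_eq_essInf_ne_zero {η : Measure X} [IsProbabilityMeasure η]
    [IsProbabilityMeasure (ψ y)] (hη : η ≪ lam) (hψ : ψ y ≪ lam) (hl : Measurable (l · y))
    (hC : ∀ x, |l x y| ≤ C) (hopt : (∫ x, l x y ∂η) + tvX lam η (ψ y) = Tval lam l ψ y)
    (hA : ψ y {x | essInf (l · y) lam + 2 < l x y} ≠ 0) :
    lam {x | l x y = essInf (l · y) lam} ≠ 0 := by
  intro h0
  have hlt : ∀ᵐ x ∂lam, essInf (l · y) lam < l x y := by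
    filter_upwards [ae_essInf_le (μ := lam) (isBoundedUnder_ge_of_abs_le hC),
      measure_eq_zero_iff_ae_notMem.1 h0] with x hx hne
    exact lt_of_le_of_ne hx (Ne.symm hne)
  exact hA (measure_eq_zero_of_cost_eq (α := fun _ ↦ essInf (l · y) lam) hη hψ hl
    measurable_const hC (fun _ ↦ abs_essInf_le hC) hlt (by simp)
    (hopt.trans (Tval_eq_integral_min hψ hl hC)))

end Parametric

section Joint

variable {X Y : Type*} [MeasurableSpace X] [MeasurableSpace Y]

lemma mixJoint_eq_map_swap_compProd (m : Measure Y) [SFinite m]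
    (κ : ProbabilityTheory.Kernel Y X) [ProbabilityTheory.IsSFiniteKernel κ] :
    mixJoint m κ = (m.compProd κ).map Prod.swap := by
  have happ (y : Y) {s : Set (X × Y)} (hs : MeasurableSet s) :
      (κ y).map (fun x ↦ (x, y)) s = κ y (Prod.mk y ⁻¹' (Prod.swap ⁻¹' s)) :=
    Measure.map_apply measurable_prodMk_right hs
  have hmeas : Measurable fun y ↦ (κ y).map fun x ↦ (x, y) := by
    refine Measure.measurable_of_measurable_coe _ fun s hs ↦ ?_
    simp_rw [happ _ hs]
    exact ProbabilityTheory.Kernel.measurable_kernel_prodMk_left (measurable_swap hs)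
  ext s hs
  rw [mixJoint, Measure.bind_apply hs hmeas.aemeasurable, Measure.map_apply measurable_swap hs,
    Measure.compProd_apply (measurable_swap hs)]
  simp_rw [happ _ hs]

lemma mixJoint_apply {m : Measure Y} [SFinite m] {κ : ProbabilityTheory.Kernel Y X}
    [ProbabilityTheory.IsSFiniteKernel κ] {s : Set (X × Y)} (hs : MeasurableSet s) :
    mixJoint m κ s = ∫⁻ y, κ y ((fun x ↦ (x, y)) ⁻¹' s) ∂m := by
  rw [mixJoint_eq_map_swap_compProd, Measure.map_apply measurable_swap hs,
    Measure.compProd_apply (measurable_swap hs)]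
  rfl

lemma integral_mixJoint {m : Measure Y} [IsFiniteMeasure m] {κ : ProbabilityTheory.Kernel Y X}
    [ProbabilityTheory.IsFiniteKernel κ] {f : X × Y → ℝ} {C : ℝ} (hf : Measurable f)
    (hC : ∀ p, |f p| ≤ C) :
    ∫ p, f p ∂(mixJoint m κ) = ∫ y, ∫ x, f (x, y) ∂κ y ∂m := by
  rw [mixJoint_eq_map_swap_compProd, integral_map measurable_swap.aemeasurable
    hf.aestronglyMeasurable, Measure.integral_compProd]
  · rfl
  · exact integrable_of_abs_le (hf.comp measurable_swap) fun p ↦ hC p.swap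

/-- Any density `r` on `Y` that vanishes where the sections of `S` are null is the `Y`-marginal of a
measure carried by `S`. -/
lemma exists_map_snd_eq_withDensity (lam : Measure X) [IsFiniteMeasure lam] (m : Measure Y)
    [SFinite m] {r : Y → ℝ≥0∞} (hr : Measurable r) {S : Set (X × Y)} (hS : MeasurableSet S)
    (hrS : ∀ y, r y ≠ 0 → lam ((fun x ↦ (x, y)) ⁻¹' S) ≠ 0) :
    ∃ N : Measure (X × Y), N ≪ lam.prod m ∧ (∀ᵐ p ∂N, p ∈ S) ∧
      N.map Prod.snd = m.withDensity r := by
  set s : Y → ℝ≥0∞ := fun y ↦ lam ((fun x ↦ (x, y)) ⁻¹' S)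
  have hs : Measurable s := measurable_measure_prodMk_right hS
  set g : X × Y → ℝ≥0∞ := S.indicator fun p ↦ r p.2 * (s p.2)⁻¹
  have hg : Measurable g :=
    ((hr.comp measurable_snd).mul (hs.comp measurable_snd).inv).indicator hS
  refine ⟨(lam.prod m).withDensity g, withDensity_absolutelyContinuous _ _, ?_, ?_⟩
  · rw [ae_withDensity_iff hg]
    exact ae_of_all _ fun p hp ↦ Set.mem_of_indicator_ne_zero hp
  · ext B hB
    rw [Measure.map_apply measurable_snd hB, withDensity_apply _ (measurable_snd hB),
      withDensity_apply _ hB, ← lintegral_indicator (measurable_snd hB), ← lintegral_indicator hB,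
      lintegral_prod_symm _ (hg.indicator (measurable_snd hB)).aemeasurable]
    refine lintegral_congr fun y ↦ ?_
    have hinner : ∫⁻ x, g (x, y) ∂lam = r y := by
      have : (fun x ↦ g (x, y)) =
          ((fun x ↦ (x, y)) ⁻¹' S).indicator fun _ ↦ r y * (s y)⁻¹ := rfl
      rw [this, lintegral_indicator_const (measurable_prodMk_right hS), mul_assoc]
      by_cases h : r y = 0
      · simp [h]
      · rw [ENNReal.inv_mul_cancel (hrS y h) (measure_ne_top _ _), mul_one]
    by_cases hy : y ∈ B
    · simpa [Set.indicator, hy] using hinner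
    · simp [Set.indicator, hy]

end Joint

/-- joint+marginal lemma, Lemma 1: if for every `y ∈ Y` the parametric
solution set `P*_y ⊆ P(X)` (the set of minimizers of the problem defining `T(y)`) is nonempty
and compact in the topology of weak convergence, then the joint optimization problem defining
`R` has an optimal solution and `R = ∫_Y T(y) m(dy)`. -/
theorem joint_marginal_lemma {X Y : Type*}
    [MeasurableSpace X] [TopologicalSpace X] [OpensMeasurableSpace X] [MeasurableSpace Y]
    (lam : Measure X) (ν : Measure Y) [IsProbabilityMeasure lam] [IsProbabilityMeasure ν]
    (l : X → Y → ℝ) (hl_meas : Measurable fun p : X × Y => l p.1 p.2)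
    (hl_bdd : ∃ C : ℝ, ∀ x y, |l x y| ≤ C)
    (m : Measure Y) [IsProbabilityMeasure m]
    (Q : Measure (X × Y)) [IsProbabilityMeasure Q]
    (hQac : Q ≪ lam.prod ν) (hQm : Q.map Prod.snd = m)
    -- the disintegration `Q(dx,dy) = ψ(dx|y) m(dy)` of `Q` over its Y-marginal `m`
    (ψ : Y → Measure X) (hψ_meas : Measurable ψ)
    (hψ_prob : ∀ y, IsProbabilityMeasure (ψ y)) (hψ_ac : ∀ y, ψ y ≪ lam)
    (hdis : Q = mixJoint m ψ)
    (hsol : ∀ y : Y,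
        {η : ProbabilityMeasure X | (η : Measure X) ≪ lam ∧
            (∫ x, l x y ∂(η : Measure X)) + tvX lam (η : Measure X) (ψ y)
              = Tval lam l ψ y}.Nonempty
          ∧ IsCompact {η : ProbabilityMeasure X | (η : Measure X) ≪ lam ∧
              (∫ x, l x y ∂(η : Measure X)) + tvX lam (η : Measure X) (ψ y)
                = Tval lam l ψ y}) :
    (∃ P : Measure (X × Y), IsProbabilityMeasure P ∧ P ≪ lam.prod ν ∧
        P.map Prod.snd = m ∧
        (∫ p, l p.1 p.2 ∂P) + tvJ lam ν P Q = Rval lam ν l m Q)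
      ∧ Rval lam ν l m Q = ∫ y, Tval lam l ψ y ∂m := by
  obtain ⟨C, hC⟩ := hl_bdd
  have hl (y : Y) : Measurable (l · y) := hl_meas.comp measurable_prodMk_right
  set a : Y → ℝ := fun y ↦ essInf (l · y) lam
  have ha : Measurable a := measurable_essInf hl_meas hC
  have haC (y : Y) : |a y| ≤ C := abs_essInf_le (hC · y)
  have ha₂ : Measurable fun p : X × Y ↦ a p.2 := ha.comp measurable_snd
  let κ : ProbabilityTheory.Kernel Y X := ⟨ψ, hψ_meas⟩
  have : ProbabilityTheory.IsMarkovKernel κ := ⟨hψ_prob⟩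
  have hdis' : Q = mixJoint m κ := hdis
  have hmν : m ≪ ν := by
    have h := hQac.map measurable_snd
    rwa [hQm, ← Measure.snd, Measure.snd_prod] at h
  have hT : ∫ p : X × Y, min (l p.1 p.2) (a p.2 + 2) ∂Q = ∫ y, Tval lam l ψ y ∂m := by
    rw [hdis', integral_mixJoint (hl_meas.min (ha₂.add_const 2))
      fun p ↦ abs_min_add_two_le (hC p.1 p.2) (haC p.2)]
    exact integral_congr_ae (ae_of_all _ fun y ↦
      (Tval_eq_integral_min (hψ_ac y) (hl y) (hC · y)).symm)
  have hal : ∀ᵐ p : X × Y ∂lam.prod ν, a p.2 ≤ l p.1 p.2 := by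
    rw [Measure.ae_prod_iff_ae_ae (measurableSet_le ha₂ hl_meas),
      Measure.ae_ae_comm (p := fun x y ↦ a y ≤ l x y) (measurableSet_le ha₂ hl_meas)]
    exact ae_of_all _ fun y ↦ ae_essInf_le (isBoundedUnder_ge_of_abs_le (hC · y))
  have hlow (P : {P : Measure (X × Y) //
      IsProbabilityMeasure P ∧ P ≪ lam.prod ν ∧ P.map Prod.snd = m}) :
      ∫ p : X × Y, min (l p.1 p.2) (a p.2 + 2) ∂Q ≤
        (∫ p, l p.1 p.2 ∂(P : Measure (X × Y))) + tvJ lam ν (P : Measure (X × Y)) Q := by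
    obtain ⟨P, hP, hPac, hPm⟩ := P
    refine integral_min_le_cost hPac hQac hl_meas ha₂ (fun p ↦ hC p.1 p.2) (fun p ↦ haC p.2) hal ?_
    rw [← integral_map (φ := Prod.snd) (f := fun y ↦ a y + 1) measurable_snd.aemeasurable
        (ha.add_const 1).aestronglyMeasurable,
      ← integral_map (φ := Prod.snd) (f := fun y ↦ a y + 1) measurable_snd.aemeasurable
        (ha.add_const 1).aestronglyMeasurable, hPm, hQm]
  set A : Set (X × Y) := {p | a p.2 + 2 < l p.1 p.2}
  have hA : MeasurableSet A := measurableSet_lt (ha₂.add_const 2) hl_meas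
  obtain ⟨N, hNac, hNS, hNm⟩ := exists_map_snd_eq_withDensity lam m
    (r := fun y ↦ ψ y ((fun x ↦ (x, y)) ⁻¹' A))
    (ProbabilityTheory.Kernel.measurable_kernel_prodMk_left (κ := κ) (measurable_swap hA))
    (measurableSet_eq_fun hl_meas ha₂) fun y hy ↦ by
      obtain ⟨η, hη, hopt⟩ := (hsol y).1
      exact measure_eq_essInf_ne_zero hη (hψ_ac y) (hl y) (hC · y) hopt hy
  have hNQ : N.map Prod.snd = (Q.restrict A).map Prod.snd := by
    ext B hB
    rw [hNm, withDensity_apply _ hB, Measure.map_apply measurable_snd hB,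
      Measure.restrict_apply (measurable_snd hB), hdis',
      mixJoint_apply ((measurable_snd hB).inter hA), ← lintegral_indicator hB]
    refine lintegral_congr fun y ↦ ?_
    by_cases hy : y ∈ B <;> simp [hy, κ, Set.preimage, Set.inter_def]
  have hNuniv : N Set.univ = Q A := by
    simpa [Measure.map_apply measurable_snd] using congrArg (· Set.univ) hNQ
  have : IsFiniteMeasure N := ⟨by rw [hNuniv]; exact measure_lt_top _ _⟩
  have hNac' : N ≪ lam.prod ν := hNac.trans (Measure.AbsolutelyContinuous.rfl.prod hmν)
  have hint : ∫ p, a p.2 ∂N = ∫ p in A, a p.2 ∂Q := by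
    rw [← integral_map (φ := Prod.snd) (f := a) measurable_snd.aemeasurable
        ha.aestronglyMeasurable, hNQ,
      integral_map measurable_snd.aemeasurable ha.aestronglyMeasurable]
  have hcost := cost_restrict_add_le (ε := 0) hQac hNac' hl_meas ha₂ (fun p ↦ hC p.1 p.2)
    (fun p ↦ haC p.2) (hNS.mono fun p hp ↦ by simpa using le_of_eq hp) hNuniv hint
  rw [zero_mul, add_zero] at hcost
  have hPm : (Q.restrict Aᶜ + N).map Prod.snd = m := by
    rw [Measure.map_add _ _ measurable_snd, hNQ, ← Measure.map_add _ _ measurable_snd, add_comm,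
      Measure.restrict_add_restrict_compl hA, hQm]
  have hPprob : IsProbabilityMeasure (Q.restrict Aᶜ + N) := ⟨by
    rw [Measure.add_apply, hNuniv, Measure.restrict_apply_univ, add_comm,
      measure_add_measure_compl hA, measure_univ]⟩
  have hPac : Q.restrict Aᶜ + N ≪ lam.prod ν :=
    (Measure.restrict_le_self.absolutelyContinuous.trans hQac).add_left hNac'
  have : Nonempty {P : Measure (X × Y) //
      IsProbabilityMeasure P ∧ P ≪ lam.prod ν ∧ P.map Prod.snd = m} := ⟨Q, ‹_›, hQac, hQm⟩
  have hge : ∫ p : X × Y, min (l p.1 p.2) (a p.2 + 2) ∂Q ≤ Rval lam ν l m Q := le_ciInf hlow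
  have hle : Rval lam ν l m Q ≤ _ :=
    ciInf_le ⟨_, Set.forall_mem_range.2 hlow⟩ ⟨Q.restrict Aᶜ + N, hPprob, hPac, hPm⟩
  exact ⟨⟨_, hPprob, hPac, hPm, le_antisymm (hcost.trans hge) hle⟩,
    hT ▸ le_antisymm (hle.trans hcost) hge⟩

end DIMG
end
end
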